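/- arXiv:0706.4118 — 5 statements merged into one kernel-verified Lean document; each statement's English description precedes it below -/
import Mathlib

section
/- Let N ≥ 1, α > 0, and let 1 ≤ σ < 4/(N−2) (interpreted as σ ≥ 1 arbitrary when N ≤ 2). Then there exists an exponent r with 2 < r ≤ 2N/(N−2) (interpreted as 2 < r ≤ 4 when N ≤ 2) and a constant C_α > 0, depending only on N, σ, α, such that: for every Schwartz function v : ℝ^N → ℂ and every Schwartz function u : ℝ^N → ℝ satisfying u − α²Δu = |v|^{σ+1} pointwise on ℝ^N, and for all Schwartz functions v₁, v₂ : ℝ^N → ℂ, one has ‖u · |v|^{σ−1} · (v₁ − v₂)‖_{L^{r'}} ≤ C_α ‖v‖_{H¹}^{2σ} ‖v₁ − v₂‖_{L^r}, where 1/r + 1/r' = 1. -/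
open MeasureTheory Real Set
open scoped ENNReal NNReal ComplexConjugate

noncomputable section

/-- Standard basis vector of `ℝ^N`. -/
def basisVec (N : ℕ) (i : Fin N) : EuclideanSpace ℝ (Fin N) :=
  EuclideanSpace.single i 1

/-- The Laplacian of a function on `ℝ^N`. -/
def lap {E : Type*} [NormedAddCommGroup E] [NormedSpace ℝ E]
    (N : ℕ) (u : EuclideanSpace ℝ (Fin N) → E) (x : EuclideanSpace ℝ (Fin N)) : E :=
  ∑ i : Fin N, fderiv ℝ (fun y => fderiv ℝ u y (basisVec N i)) x (basisVec N i)

/-- The `L^p` norm (with real exponent `p`) of a function on `ℝ^N`. -/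
def LpN (N : ℕ) {E : Type*} [NormedAddCommGroup E]
    (f : EuclideanSpace ℝ (Fin N) → E) (p : ℝ) : ℝ :=
  (eLpNorm f (ENNReal.ofReal p) volume).toReal

/-- The `L²` norm of the (total) derivative of a function on `ℝ^N`. -/
def gradL2 (N : ℕ) (v : EuclideanSpace ℝ (Fin N) → ℂ) : ℝ :=
  (eLpNorm (fun x => fderiv ℝ v x) 2 volume).toReal

/-- The `H¹` norm of a function on `ℝ^N`. -/
def H1norm (N : ℕ) (v : EuclideanSpace ℝ (Fin N) → ℂ) : ℝ :=
  Real.sqrt ((LpN N v 2) ^ 2 + (gradL2 N v) ^ 2)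

local notation "𝔼" N:max => EuclideanSpace ℝ (Fin N)

/-- The `H¹` norm (up to equivalence) of a function, with values in `[0, ∞]`. -/
def sobNorm {N : ℕ} {F : Type*} [NormedAddCommGroup F] [NormedSpace ℝ F] (f : 𝔼 N → F) : ℝ≥0∞ :=
  eLpNorm f 2 volume + eLpNorm (fderiv ℝ f) 2 volume

lemma eLpNorm_two_mul_fderiv_le {N : ℕ} {g f : 𝔼 N → ℂ} (hg : Continuous g)
    (hf : ContDiff ℝ 1 f) :
    eLpNorm (fun x => ‖g x‖ * ‖fderiv ℝ f x‖) 1 volume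
      ≤ eLpNorm g 2 volume * eLpNorm (fderiv ℝ f) 2 volume := by
  have h := eLpNorm_le_eLpNorm_mul_eLpNorm'_of_norm (p := 2) (q := 2) (r := 1) (μ := volume)
    (f := g) (g := fderiv ℝ f) hg.aestronglyMeasurable
    (hf.continuous_fderiv one_ne_zero).aestronglyMeasurable (fun a b => ‖a‖ * ‖b‖) 1
    (Filter.Eventually.of_forall fun x => by simp)
  simpa using h

lemma eLpNorm_one_fderiv_pow_succ_le {N : ℕ} {f : 𝔼 N → ℂ} (hf : ContDiff ℝ 1 f) (k : ℕ) :
    eLpNorm (fderiv ℝ (fun x => f x ^ (k + 1))) 1 volume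
      ≤ (k + 1 : ℕ) * (eLpNorm (fun x => f x ^ k) 2 volume * sobNorm f) := by
  have hd : ∀ x, ‖fderiv ℝ (fun x => f x ^ (k + 1)) x‖
      ≤ ((k + 1 : ℕ) : ℝ) * ‖(‖f x ^ k‖ * ‖fderiv ℝ f x‖)‖ := by
    intro x
    rw [((hf.differentiable one_ne_zero x).hasFDerivAt.pow (k + 1)).fderiv]
    have hk : ‖(k : ℂ) + 1‖ = k + 1 := mod_cast Complex.norm_natCast (k + 1)
    simp [norm_smul, mul_assoc, hk]
  calc _ ≤ ENNReal.ofReal ((k + 1 : ℕ) : ℝ) *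
        eLpNorm (fun x => ‖f x ^ k‖ * ‖fderiv ℝ f x‖) 1 volume :=
        eLpNorm_le_mul_eLpNorm_of_ae_le_mul (Filter.Eventually.of_forall hd) 1
    _ ≤ _ := by
        rw [ENNReal.ofReal_natCast]
        gcongr
        exact (eLpNorm_two_mul_fderiv_le (hf.continuous.pow k) hf).trans
          (mul_le_mul_right le_add_self _)

lemma enorm_le_eLpNorm_fderiv_dim_one {f : 𝔼 1 → ℂ} (hf : ContDiff ℝ 1 f)
    (h2f : HasCompactSupport f) (x : 𝔼 1) :
    ‖f x‖ₑ ≤ eLpNorm (fderiv ℝ f) 1 volume := by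
  let e : ℝ ≃ₗᵢ[ℝ] 𝔼 1 := LinearIsometryEquiv.ofSurjective
    (LinearIsometry.toSpanSingleton ℝ (𝔼 1) (v := basisVec 1 0) (by simp [basisVec]))
    (fun y => ⟨y 0, by ext i; fin_cases i; simp [basisVec]⟩)
  have hc : ContDiff ℝ 1 (f ∘ e) := hf.comp e.contDiff
  have hs : HasCompactSupport (f ∘ e) := h2f.comp_homeomorph e.toHomeomorph
  have h := HasCompactSupport.enorm_le_lintegral_Ici_deriv hc hs (e.symm x)
  simp only [Function.comp_apply, e.apply_symm_apply] at h
  refine h.trans ((setLIntegral_le_lintegral _ _).trans ?_)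
  rw [eLpNorm_one_eq_lintegral_enorm]
  rw [← e.measurePreserving.lintegral_comp_emb e.toHomeomorph.measurableEmbedding]
  refine lintegral_mono fun t => ?_
  have : deriv (f ∘ e) t = fderiv ℝ f (e t) (e 1) := by
    have h1 := (hf.differentiable one_ne_zero (e t)).hasFDerivAt.comp_hasDerivAt t
      (e.toContinuousLinearEquiv.toContinuousLinearMap.hasDerivAt (x := t))
    exact h1.deriv
  rw [this, enorm_le_iff_norm_le]
  refine ((fderiv ℝ f (e t)).le_opNorm _).trans ?_
  simp

/-- `L^q` is controlled by `H¹` on compactly supported `C¹` functions. -/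
def CompactSobolev (N : ℕ) (q : ℝ) : Prop :=
  ∃ C : ℝ≥0, ∀ f : 𝔼 N → ℂ, ContDiff ℝ 1 f → HasCompactSupport f →
    eLpNorm f (ENNReal.ofReal q) volume ≤ C * sobNorm f

/-- `L^q` is controlled by `H¹` on `C¹` functions. -/
def Sobolev (N : ℕ) (q : ℝ) : Prop :=
  ∃ C : ℝ≥0, ∀ f : 𝔼 N → ℂ, ContDiff ℝ 1 f →
    eLpNorm f (ENNReal.ofReal q) volume ≤ C * sobNorm f

lemma compactSobolev_of_pow {N : ℕ} {k : ℕ} (hk : k ≠ 0)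
    (h : ∃ C : ℝ≥0, ∀ f : 𝔼 N → ℂ, ContDiff ℝ 1 f → HasCompactSupport f →
      eLpNorm (fun x => f x ^ k) 2 volume ≤ C * sobNorm f ^ k) :
    CompactSobolev N (2 * k) := by
  obtain ⟨C, hC⟩ := h
  refine ⟨C ^ (1 / k : ℝ), fun f hf h2f => ?_⟩
  have hk' : (0 : ℝ) < k := by positivity
  have h1 := hC f hf h2f
  have h2 := eLpNorm_norm_rpow (μ := volume) (p := 2) f hk'
  have h3 : eLpNorm (fun x => f x ^ k) 2 volume = eLpNorm (fun x => ‖f x‖ ^ (k : ℝ)) 2 volume := by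
    refine eLpNorm_congr_norm_ae (Filter.Eventually.of_forall fun x => ?_)
    simp
  rw [h3, h2] at h1
  rw [ENNReal.ofReal_mul (by norm_num), ENNReal.ofReal_ofNat]
  rw [← ENNReal.rpow_le_rpow_iff hk', ENNReal.mul_rpow_of_nonneg _ _ hk'.le,
    ← ENNReal.coe_rpow_of_nonneg _ hk'.le, ← NNReal.rpow_mul]
  simpa [hk'.ne'] using h1

lemma pow_bound_dim_two (k : ℕ) : ∃ C : ℝ≥0, ∀ f : 𝔼 2 → ℂ, ContDiff ℝ 1 f →
    HasCompactSupport f → eLpNorm (fun x => f x ^ (k + 1)) 2 volume ≤ C * sobNorm f ^ (k + 1) := by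
  induction k with
  | zero => exact ⟨1, fun f _ _ => by simp [sobNorm]⟩
  | succ k ih =>
    obtain ⟨C, hC⟩ := ih
    have hp : NNReal.HolderConjugate (Module.finrank ℝ (𝔼 2) : ℝ≥0) 2 := by
      rw [NNReal.holderConjugate_iff]
      simp
      rw [← NNReal.coe_inj]; push_cast; norm_num
    refine ⟨eLpNormLESNormFDerivOneConst (volume : Measure (𝔼 2)) 2 * ((k + 2 : ℕ) * C),
      fun f hf h2f => ?_⟩
    have h2 : HasCompactSupport fun x => f x ^ (k + 2) :=
      h2f.comp_left (g := fun z => z ^ (k + 2)) (by simp)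
    have h1 := eLpNorm_le_eLpNorm_fderiv_one (volume : Measure (𝔼 2)) (hf.pow (k + 2)) h2 hp
    refine h1.trans ?_
    push_cast [mul_assoc]
    gcongr
    refine (eLpNorm_one_fderiv_pow_succ_le hf (k + 1)).trans ?_
    push_cast
    rw [add_assoc, one_add_one_eq_two, pow_succ (sobNorm f) (k + 1), ← mul_assoc (C : ℝ≥0∞)]
    gcongr
    exact hC f hf h2f

lemma pow_bound_dim_one (k : ℕ) : ∃ C : ℝ≥0, ∀ f : 𝔼 1 → ℂ, ContDiff ℝ 1 f →
    HasCompactSupport f →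
      eLpNorm (fun x => f x ^ (2 * k + 1)) 2 volume ≤ C * sobNorm f ^ (2 * k + 1) := by
  induction k with
  | zero => exact ⟨1, fun f _ _ => by simp [sobNorm]⟩
  | succ k ih =>
    obtain ⟨C, hC⟩ := ih
    refine ⟨2 * C, fun f hf h2f => ?_⟩
    have h2 : HasCompactSupport fun x => f x ^ (1 + 1) :=
      h2f.comp_left (g := fun z => z ^ (1 + 1)) (by simp)
    have hsup : ∀ x, ‖f x ^ 2‖ₑ ≤ 2 * sobNorm f ^ 2 := fun x => by
      refine (enorm_le_eLpNorm_fderiv_dim_one (hf.pow (1 + 1)) h2 x).trans ?_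
      refine (eLpNorm_one_fderiv_pow_succ_le hf 1).trans ?_
      rw [pow_two (sobNorm f)]
      rw [show ((1 + 1 : ℕ) : ℝ≥0∞) = 2 by norm_num]
      gcongr
      simp [sobNorm]
    calc _ ≤ 2 * sobNorm f ^ 2 * eLpNorm (fun x => f x ^ (2 * k + 1)) 2 volume := by
          refine eLpNorm_le_mul_eLpNorm_of_ae_le_mul'' 2
            (hf.continuous.pow _).aestronglyMeasurable (Filter.Eventually.of_forall fun x => ?_)
          rw [show 2 * (k + 1) + 1 = 2 + (2 * k + 1) by ring, pow_add, enorm_mul]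
          gcongr
          exact hsup x
      _ ≤ 2 * sobNorm f ^ 2 * (C * sobNorm f ^ (2 * k + 1)) := by
          gcongr
          exact hC f hf h2f
      _ = _ := by
          push_cast
          ring

lemma compactSobolev_critical {N : ℕ} (hN : 2 < N) : CompactSobolev N (2 * N / ((N : ℝ) - 2)) := by
  have hN' : (2 : ℝ) < N := by exact_mod_cast hN
  have h0 : 0 ≤ 2 * N / ((N : ℝ) - 2) := div_nonneg (by positivity) (by linarith)
  refine ⟨SNormLESNormFDerivOfEqConst ℂ (volume : Measure (𝔼 N)) (2 : ℝ≥0), fun f hf h2f => ?_⟩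
  have h := eLpNorm_le_eLpNorm_fderiv_of_eq (volume : Measure (𝔼 N)) hf h2f (p := 2)
    (p' := (2 * N / ((N : ℝ) - 2)).toNNReal) (by norm_num) (by simp; omega) (by
      rw [Real.coe_toNNReal _ h0]
      simp
      have : (N : ℝ) - 2 ≠ 0 := by linarith
      field_simp)
  refine h.trans ?_
  gcongr
  exact le_add_self

lemma sobNorm_cutoff_le {N : ℕ} {f : 𝔼 N → ℂ} (hf : ContDiff ℝ 1 f) {φ : 𝔼 N → ℝ}
    (hφ : ContDiff ℝ 1 φ) (hφ1 : ∀ x, ‖φ x‖ ≤ 1) {M : ℝ≥0} (hM : ∀ x, ‖fderiv ℝ φ x‖ ≤ M) :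
    sobNorm (fun x => φ x • f x) ≤ (1 + M : ℝ≥0) * sobNorm f := by
  have h1 : eLpNorm (fun x => φ x • f x) 2 volume ≤ eLpNorm f 2 volume :=
    eLpNorm_mono fun x => by
      rw [norm_smul]
      exact mul_le_of_le_one_left (norm_nonneg _) (hφ1 x)
  have h2 : fderiv ℝ (fun x => φ x • f x)
      = (fun x => φ x • fderiv ℝ f x) + fun x => (fderiv ℝ φ x).smulRight (f x) := by
    funext x
    exact ((hφ.differentiable one_ne_zero x).hasFDerivAt.smul
      (hf.differentiable one_ne_zero x).hasFDerivAt).fderiv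
  have hc' := hf.continuous_fderiv one_ne_zero
  have h3 : eLpNorm (fun x => φ x • fderiv ℝ f x) 2 volume ≤ eLpNorm (fderiv ℝ f) 2 volume :=
    eLpNorm_mono fun x => by
      rw [norm_smul]
      exact mul_le_of_le_one_left (norm_nonneg _) (hφ1 x)
  have h4 : eLpNorm (fun x => (fderiv ℝ φ x).smulRight (f x)) 2 volume
      ≤ M * eLpNorm f 2 volume := by
    have := eLpNorm_le_nnreal_smul_eLpNorm_of_ae_le_mul (μ := volume) (c := M) (g := f)
      (f := fun x => (fderiv ℝ φ x).smulRight (f x)) (Filter.Eventually.of_forall fun x => by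
        rw [← NNReal.coe_le_coe]
        push_cast
        rw [ContinuousLinearMap.norm_smulRight_apply]
        gcongr
        exact hM x) 2
    simpa [ENNReal.smul_def] using this
  have hm1 : AEStronglyMeasurable (fun x => φ x • fderiv ℝ f x) volume :=
    (hφ.continuous.smul hc').aestronglyMeasurable
  have hm2 : AEStronglyMeasurable (fun x => (fderiv ℝ φ x).smulRight (f x)) volume := by
    have := hφ.continuous_fderiv one_ne_zero
    have := hf.continuous
    exact Continuous.aestronglyMeasurable
      ((ContinuousLinearMap.smulRightL ℝ (𝔼 N) ℂ).continuous₂.comp₂ ‹_› ‹_›)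
  calc sobNorm (fun x => φ x • f x)
      ≤ eLpNorm f 2 volume + (eLpNorm (fderiv ℝ f) 2 volume + M * eLpNorm f 2 volume) := by
        unfold sobNorm
        rw [h2]
        gcongr
        exact (eLpNorm_add_le hm1 hm2 (by norm_num)).trans (add_le_add h3 h4)
    _ ≤ eLpNorm f 2 volume + (eLpNorm (fderiv ℝ f) 2 volume + M * sobNorm f) := by
        gcongr
        exact le_self_add
    _ = _ := by
        push_cast
        rw [sobNorm]
        ring

lemma CompactSobolev.sobolev {N : ℕ} {q : ℝ} (h : CompactSobolev N q) : Sobolev N q := by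
  obtain ⟨C, hC⟩ := h
  let χ : ContDiffBump (0 : 𝔼 N) := ⟨1, 2, one_pos, one_lt_two⟩
  have hχ : ContDiff ℝ 1 χ := χ.contDiff
  obtain ⟨M, hM⟩ : ∃ M, ∀ x, ‖fderiv ℝ χ x‖ ≤ M :=
    (hχ.continuous_fderiv one_ne_zero).bounded_above_of_compact_support
      (χ.hasCompactSupport.fderiv ℝ)
  lift M to ℝ≥0 using (norm_nonneg _).trans (hM 0)
  refine ⟨C * (1 + M), fun f hf => ?_⟩
  let s : ℕ → ℝ := fun n => ((n : ℝ) + 1)⁻¹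
  have hs0 : ∀ n, 0 < s n := fun n => by positivity
  have hs1 : ∀ n, s n ≤ 1 := fun n => inv_le_one_of_one_le₀ (by simp)
  let φ : ℕ → 𝔼 N → ℝ := fun n x => χ (s n • x)
  have hφ : ∀ n, ContDiff ℝ 1 (φ n) := fun n => hχ.comp (contDiff_const_smul _)
  have hφ1 : ∀ n x, ‖φ n x‖ ≤ 1 := fun n x => by
    rw [Real.norm_of_nonneg χ.nonneg]
    exact χ.le_one
  have hφM : ∀ n x, ‖fderiv ℝ (φ n) x‖ ≤ M := fun n x => by
    have h1 : fderiv ℝ (φ n) x = s n • fderiv ℝ χ (s n • x) := fderiv_comp_smul _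
    rw [h1, norm_smul, Real.norm_of_nonneg (hs0 n).le]
    exact (mul_le_of_le_one_left (norm_nonneg _) (hs1 n)).trans (hM _)
  have hsupp : ∀ n, HasCompactSupport (fun x => φ n x • f x) := fun n => by
    have : HasCompactSupport (φ n) := χ.hasCompactSupport.comp_smul (hs0 n).ne'
    exact this.smul_right
  have hlim : ∀ x, Filter.Tendsto (fun n => φ n x • f x) Filter.atTop (nhds (f x)) := fun x => by
    have h1 : Filter.Tendsto (fun n => s n • x) Filter.atTop (nhds 0) := by
      have := (tendsto_one_div_add_atTop_nhds_zero_nat (𝕜 := ℝ)).smul_const x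
      simpa [s] using this
    have h2 := ((hχ.continuous.tendsto 0).comp h1).smul_const (f x)
    rw [χ.one_of_mem_closedBall (by simp [χ]), one_smul] at h2
    exact h2
  refine (Lp.eLpNorm_lim_le_liminf_eLpNorm
    (fun n => ((hφ n).continuous.smul hf.continuous).aestronglyMeasurable) f
    (Filter.Eventually.of_forall hlim)).trans ?_
  refine (Filter.liminf_le_liminf (v := fun _ => ((C * (1 + M) : ℝ≥0) : ℝ≥0∞) * sobNorm f)
    (Filter.Eventually.of_forall fun n => ?_)).trans (by simp)
  refine (hC _ ((hφ n).smul hf) (hsupp n)).trans ?_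
  rw [ENNReal.coe_mul, mul_assoc]
  gcongr
  exact sobNorm_cutoff_le hf (hφ n) (hφ1 n) (hφM n)

lemma eLpNorm_le_of_le_of_le {X E : Type*} [MeasurableSpace X] {μ : Measure X}
    [NormedAddCommGroup E] {f : X → E} (hf : AEStronglyMeasurable f μ) {a q b : ℝ} (ha : 0 < a)
    (haq : a ≤ q) (hqb : q ≤ b) {K : ℝ≥0∞} (h1 : eLpNorm f (ENNReal.ofReal a) μ ≤ K)
    (h2 : eLpNorm f (ENNReal.ofReal b) μ ≤ K) : eLpNorm f (ENNReal.ofReal q) μ ≤ K := by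
  have hq : 0 < q := ha.trans_le haq
  have hb : 0 < b := hq.trans_le hqb
  have key : ∀ p : ℝ, 0 < p → (eLpNorm f (ENNReal.ofReal p) μ ≤ K ↔
      ∫⁻ x, ‖f x‖ₑ ^ p ∂μ ≤ K ^ p) := fun p hp => by
    rw [eLpNorm_eq_lintegral_rpow_enorm_toReal (by simpa using hp) ENNReal.ofReal_ne_top,
      ENNReal.toReal_ofReal hp.le, one_div, ENNReal.rpow_inv_le_iff hp]
  rw [key a ha] at h1
  rw [key b hb] at h2
  rw [key q hq]
  obtain ⟨s, t, hs, ht, hst, rfl⟩ : ∃ s t : ℝ, 0 ≤ s ∧ 0 ≤ t ∧ s + t = 1 ∧ a * s + b * t = q := by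
    have hmem : q ∈ segment ℝ a b := by
      rw [segment_eq_Icc (haq.trans hqb)]
      exact ⟨haq, hqb⟩
    obtain ⟨s, t, hs, ht, hst, h⟩ := hmem
    exact ⟨s, t, hs, ht, hst, by rw [← h, smul_eq_mul, smul_eq_mul]; ring⟩
  calc ∫⁻ x, ‖f x‖ₑ ^ (a * s + b * t) ∂μ = ∫⁻ x, (‖f x‖ₑ ^ a) ^ s * (‖f x‖ₑ ^ b) ^ t ∂μ := by
        refine lintegral_congr fun x => ?_
        rw [← ENNReal.rpow_mul, ← ENNReal.rpow_mul, ENNReal.rpow_add_of_nonneg] <;> positivity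
    _ ≤ _ := ENNReal.lintegral_mul_norm_pow_le (hf.enorm.pow_const a) (hf.enorm.pow_const b)
          hs ht hst
    _ ≤ (K ^ a) ^ s * (K ^ b) ^ t := by gcongr
    _ = _ := by
        rw [← ENNReal.rpow_mul, ← ENNReal.rpow_mul, ENNReal.rpow_add_of_nonneg] <;> positivity

lemma Sobolev.of_le {N : ℕ} {p q : ℝ} (h : Sobolev N p) (hq : 2 ≤ q) (hqp : q ≤ p) :
    Sobolev N q := by
  obtain ⟨C, hC⟩ := h
  refine ⟨C + 1, fun f hf => ?_⟩
  refine eLpNorm_le_of_le_of_le hf.continuous.aestronglyMeasurable two_pos hq hqp ?_ ?_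
  · rw [ENNReal.ofReal_ofNat]
    refine (le_self_add : _ ≤ sobNorm f).trans ?_
    push_cast
    rw [add_mul, one_mul]
    exact le_add_self
  · refine (hC f hf).trans ?_
    gcongr
    simp

lemma sobolev_of_le_critical {N : ℕ} (hN : 2 < N) {q : ℝ} (hq : 2 ≤ q)
    (hq' : q ≤ 2 * N / ((N : ℝ) - 2)) : Sobolev N q :=
  (compactSobolev_critical hN).sobolev.of_le hq hq'

lemma sobolev_of_dim_le_two {N : ℕ} (hN : 1 ≤ N) (hN2 : N ≤ 2) {q : ℝ} (hq : 2 ≤ q) :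
    Sobolev N q := by
  obtain ⟨k, hk⟩ := exists_nat_ge q
  have h : CompactSobolev N (2 * (2 * k + 1 : ℕ)) := by
    refine compactSobolev_of_pow (by omega) ?_
    interval_cases N
    · exact pow_bound_dim_one k
    · exact pow_bound_dim_two (2 * k)
  refine h.sobolev.of_le hq ?_
  push_cast
  linarith [(Nat.cast_nonneg k : (0 : ℝ) ≤ k)]

lemma norm_sq_le_sum_apply_basisVec {N : ℕ} (L : 𝔼 N →L[ℝ] ℝ) :
    ‖L‖ ^ 2 ≤ ∑ i, L (basisVec N i) ^ 2 := by
  have h0 : 0 ≤ ∑ i, L (basisVec N i) ^ 2 := by positivity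
  rw [← Real.le_sqrt (norm_nonneg _) h0]
  refine L.opNorm_le_bound (Real.sqrt_nonneg _) fun x => ?_
  have hx : x = ∑ i, x i • basisVec N i := by
    have := (EuclideanSpace.basisFun (Fin N) ℝ).sum_repr x
    simpa [basisVec] using this.symm
  have hL : L x = ∑ i, L (basisVec N i) * x i := by
    conv_lhs => rw [hx]
    simp [mul_comm]
  rw [hL, EuclideanSpace.norm_eq]
  simp only [Real.norm_eq_abs, sq_abs]
  refine Real.abs_le_sqrt ?_ |>.trans (Real.sqrt_mul h0 _).le
  exact Finset.sum_mul_sq_le_sq_mul_sq _ _ _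

lemma SchwartzMap.integrable_mul_real {N : ℕ} (f g : SchwartzMap (𝔼 N) ℝ) :
    Integrable (fun x => f x * g x) volume :=
  (f.memLp 2 volume).integrable_mul (g.memLp 2 volume)

open LineDeriv in
lemma integral_sq_add_integral_fderiv_sq_le {N : ℕ} (u : SchwartzMap (𝔼 N) ℝ) (α : ℝ)
    {g : 𝔼 N → ℝ} (h : ∀ x, u x - α ^ 2 * lap N (fun y => u y) x = g x) :
    (∫ x, ‖u x‖ ^ 2) + α ^ 2 * ∫ x, ‖fderiv ℝ u x‖ ^ 2 ≤ ∫ x, g x * u x := by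
  let D : Fin N → SchwartzMap (𝔼 N) ℝ := fun i => ∂_{basisVec N i} u
  let D2 : Fin N → SchwartzMap (𝔼 N) ℝ := fun i => ∂_{basisVec N i} (D i)
  have hlap : ∀ x, lap N (fun y => u y) x = ∑ i, D2 i x := fun x => rfl
  have hparts : ∀ i, ∫ x, u x * D2 i x = - ∫ x, D i x * D i x := fun i =>
    SchwartzMap.integral_mul_lineDerivOp_right_eq_neg_left u (D i) (basisVec N i)
  have hgrad : ∫ x, ‖fderiv ℝ u x‖ ^ 2 ≤ ∑ i, ∫ x, D i x * D i x := by
    rw [← integral_finsetSum _ fun i _ => (D i).integrable_mul_real (D i)]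
    refine integral_mono_of_nonneg (Filter.Eventually.of_forall fun x => by positivity)
      (integrable_finsetSum _ fun i _ => (D i).integrable_mul_real (D i))
      (Filter.Eventually.of_forall fun x => ?_)
    refine (norm_sq_le_sum_apply_basisVec (fderiv ℝ u x)).trans_eq ?_
    exact Finset.sum_congr rfl fun i _ => pow_two _
  have hg : ∫ x, g x * u x = (∫ x, ‖u x‖ ^ 2) + α ^ 2 * ∑ i, ∫ x, D i x * D i x := by
    have h1 : ∀ x, g x * u x = u x * u x - α ^ 2 * ∑ i, u x * D2 i x := fun x => by
      rw [← h x, hlap, sub_mul, mul_assoc, mul_comm (∑ i, D2 i x), Finset.mul_sum]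
    have h2 : ∀ x, ‖u x‖ ^ 2 = u x * u x := fun x => by
      rw [Real.norm_eq_abs, sq_abs, pow_two]
    simp_rw [h1, h2]
    rw [integral_sub (u.integrable_mul_real u)
      ((integrable_finsetSum _ fun i _ => u.integrable_mul_real (D2 i)).const_mul _),
      integral_const_mul, integral_finsetSum _ fun i _ => u.integrable_mul_real (D2 i)]
    simp_rw [hparts]
    rw [Finset.sum_neg_distrib]
    ring
  rw [hg]
  gcongr

lemma toReal_eLpNorm_two_sq {X E : Type*} [MeasurableSpace X] {μ : Measure X}
    [NormedAddCommGroup E] {f : X → E} (hf : MemLp f 2 μ) :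
    (eLpNorm f 2 μ).toReal ^ 2 = ∫ x, ‖f x‖ ^ 2 ∂μ := by
  have h0 : 0 ≤ ∫ x, ‖f x‖ ^ 2 ∂μ := by positivity
  rw [hf.eLpNorm_eq_integral_rpow_norm two_ne_zero ENNReal.ofNat_ne_top]
  simp only [ENNReal.toReal_ofNat, Real.rpow_two]
  rw [ENNReal.toReal_ofReal (by positivity), ← Real.rpow_two, ← Real.rpow_mul h0]
  simp

lemma SchwartzMap.memLp_fderiv {N : ℕ} {F : Type*} [NormedAddCommGroup F] [NormedSpace ℝ F]
    (f : SchwartzMap (𝔼 N) F) (p : ℝ≥0∞) : MemLp (fderiv ℝ f) p volume :=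
  (SchwartzMap.fderivCLM ℝ (𝔼 N) F f).memLp p volume

lemma SchwartzMap.sobNorm_ne_top {N : ℕ} {F : Type*} [NormedAddCommGroup F] [NormedSpace ℝ F]
    (f : SchwartzMap (𝔼 N) F) : sobNorm f ≠ ∞ :=
  ENNReal.add_ne_top.2 ⟨(f.memLp 2 volume).eLpNorm_ne_top, (f.memLp_fderiv 2).eLpNorm_ne_top⟩

lemma sobNorm_toReal_le (N : ℕ) (v : SchwartzMap (𝔼 N) ℂ) :
    (sobNorm v).toReal ≤ 2 * H1norm N v := by
  rw [sobNorm, ENNReal.toReal_add (v.memLp 2 volume).eLpNorm_ne_top (v.memLp_fderiv 2).eLpNorm_ne_top,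
    H1norm, LpN, gradL2, ENNReal.ofReal_ofNat, two_mul]
  gcongr
  · exact Real.le_sqrt_of_sq_le (le_add_of_nonneg_right (sq_nonneg _))
  · exact Real.le_sqrt_of_sq_le (le_add_of_nonneg_left (sq_nonneg _))

lemma Sobolev.real {N : ℕ} {q : ℝ} (h : Sobolev N q) :
    ∃ C : ℝ, 0 ≤ C ∧
      (∀ v : SchwartzMap (𝔼 N) ℂ, LpN N v q ≤ C * H1norm N v) ∧
      ∀ u : SchwartzMap (𝔼 N) ℝ, LpN N u q ≤ C * (sobNorm u).toReal := by
  obtain ⟨C, hC⟩ := h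
  refine ⟨C * 2, by positivity, fun v => ?_, fun u => ?_⟩
  · have h1 := ENNReal.toReal_mono (ENNReal.mul_ne_top ENNReal.coe_ne_top v.sobNorm_ne_top)
      (hC v (v.smooth 1))
    rw [ENNReal.toReal_mul, ENNReal.coe_toReal] at h1
    rw [mul_assoc]
    exact h1.trans (by gcongr; exact sobNorm_toReal_le N v)
  · have hu : ContDiff ℝ 1 u := u.smooth 1
    have h1 := hC (fun x => (u x : ℂ)) (Complex.ofRealCLM.contDiff.comp hu)
    have h2 : eLpNorm (fun x => (u x : ℂ)) (ENNReal.ofReal q) volume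
        = eLpNorm u (ENNReal.ofReal q) volume :=
      eLpNorm_congr_norm_ae (Filter.Eventually.of_forall fun x => by simp)
    have h3 : sobNorm (fun x => (u x : ℂ)) ≤ sobNorm u := by
      refine add_le_add (eLpNorm_mono fun x => by simp) (eLpNorm_mono fun x => ?_)
      have : fderiv ℝ (fun x => (u x : ℂ)) x = Complex.ofRealCLM.comp (fderiv ℝ u x) :=
        (Complex.ofRealCLM.hasFDerivAt.comp x (hu.differentiable one_ne_zero x).hasFDerivAt).fderiv
      rw [this]
      refine (ContinuousLinearMap.opNorm_comp_le _ _).trans ?_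
      simp
    rw [h2] at h1
    have h4 := ENNReal.toReal_mono (ENNReal.mul_ne_top ENNReal.coe_ne_top u.sobNorm_ne_top)
      (h1.trans (mul_le_mul_right h3 _))
    rw [ENNReal.toReal_mul, ENNReal.coe_toReal] at h4
    refine h4.trans ?_
    gcongr
    exact le_mul_of_one_le_right (by positivity) one_le_two

lemma integral_mul_le_LpN_mul_LpN {N : ℕ} {p q : ℝ} (hpq : p.HolderConjugate q)
    {f g : 𝔼 N → ℝ} (hf : MemLp f (ENNReal.ofReal p) volume)
    (hg : MemLp g (ENNReal.ofReal q) volume) :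
    ∫ x, f x * g x ≤ LpN N f p * LpN N g q := by
  have := hpq.ennrealOfReal
  have h := eLpNorm_le_eLpNorm_mul_eLpNorm'_of_norm (p := ENNReal.ofReal p)
    (q := ENNReal.ofReal q) (r := 1) hf.1 hg.1 (fun a b => a * b) 1
    (Filter.Eventually.of_forall fun x => by simp)
  rw [ENNReal.coe_one, one_mul, eLpNorm_one_eq_lintegral_enorm] at h
  rw [LpN, LpN, ← ENNReal.toReal_mul]
  calc ∫ x, f x * g x ≤ ∫ x, ‖f x * g x‖ :=
        (Real.le_norm_self _).trans (norm_integral_le_integral_norm _)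
    _ = (∫⁻ x, ‖f x * g x‖ₑ).toReal := integral_norm_eq_lintegral_enorm (hf.1.mul hg.1)
    _ ≤ _ := ENNReal.toReal_mono (ENNReal.mul_ne_top hf.eLpNorm_ne_top hg.eLpNorm_ne_top) h

/-- Energy estimate for the Helmholtz equation. -/
lemma sobNorm_le_of_helmholtz {N : ℕ} {s s' α : ℝ} (hα : 0 < α) (hs : s'.HolderConjugate s)
    {C : ℝ} (hC0 : 0 ≤ C) {u : SchwartzMap (𝔼 N) ℝ} (hC : LpN N u s ≤ C * (sobNorm u).toReal)
    {g : 𝔼 N → ℝ} (hg : MemLp g (ENNReal.ofReal s') volume)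
    (h : ∀ x, u x - α ^ 2 * lap N (fun y => u y) x = g x) :
    (sobNorm u).toReal ≤ 2 / min 1 (α ^ 2) * C * LpN N g s' := by
  have hE := (integral_sq_add_integral_fderiv_sq_le u α h).trans
    (integral_mul_le_LpN_mul_LpN hs hg (u.memLp _ volume))
  rw [← toReal_eLpNorm_two_sq (u.memLp 2 volume), ← toReal_eLpNorm_two_sq (u.memLp_fderiv 2)] at hE
  have hS : (sobNorm u).toReal
      = (eLpNorm u 2 volume).toReal + (eLpNorm (fderiv ℝ u) 2 volume).toReal :=
    ENNReal.toReal_add (u.memLp 2 volume).eLpNorm_ne_top (u.memLp_fderiv 2).eLpNorm_ne_top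
  set S := (sobNorm u).toReal
  set a := (eLpNorm u 2 volume).toReal
  set b := (eLpNorm (fderiv ℝ u) 2 volume).toReal
  have hG : 0 ≤ LpN N g s' := ENNReal.toReal_nonneg
  set G := LpN N g s'
  have hS0 : 0 ≤ S := ENNReal.toReal_nonneg
  have hm : 0 < min 1 (α ^ 2) := by positivity
  have hm1 : min 1 (α ^ 2) ≤ 1 := min_le_left _ _
  have hm2 : min 1 (α ^ 2) ≤ α ^ 2 := min_le_right _ _
  set m := min 1 (α ^ 2)
  have h1 : m * S ^ 2 ≤ 2 * C * G * S := by
    have h2 : m * (a ^ 2 + b ^ 2) ≤ G * (C * S) :=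
      calc _ ≤ a ^ 2 + α ^ 2 * b ^ 2 := by nlinarith [sq_nonneg a, sq_nonneg b]
        _ ≤ _ := hE.trans (by gcongr)
    have h3 : S ^ 2 ≤ 2 * (a ^ 2 + b ^ 2) := by
      rw [hS]
      nlinarith [sq_nonneg (a - b)]
    nlinarith
  rcases hS0.eq_or_lt with h0 | h0
  · rw [← h0]
    positivity
  · have h2 : m * S ≤ 2 * C * G := by
      refine le_of_mul_le_mul_right ?_ h0
      linarith
    rw [div_mul_eq_mul_div, div_mul_eq_mul_div, le_div_iff₀ hm]
    linarith

lemma eLpNorm_mul_rpow_mul_le {X : Type*} [MeasurableSpace X] {μ : Measure X}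
    {u : X → ℝ} {v w : X → ℂ} (hu : AEStronglyMeasurable u μ) (hv : AEStronglyMeasurable v μ)
    (hw : AEStronglyMeasurable w μ) {q r r' τ : ℝ} (hq : 0 < q) (hr : 0 < r) (hr' : 0 < r')
    (hτ : 0 ≤ τ) (h : 1 / q + τ / q + 1 / r = 1 / r') :
    eLpNorm (fun x => (u x : ℂ) * ((‖v x‖ ^ τ : ℝ) : ℂ) * w x) (ENNReal.ofReal r') μ
      ≤ eLpNorm u (ENNReal.ofReal q) μ * eLpNorm v (ENNReal.ofReal q) μ ^ τ
        * eLpNorm w (ENNReal.ofReal r) μ := by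
  have key : ∀ {E : Type} [NormedAddCommGroup E] (f : X → E) (p : ℝ), 0 < p →
      eLpNorm f (ENNReal.ofReal p) μ = (∫⁻ x, ‖f x‖ₑ ^ p ∂μ) ^ (1 / p) := by
    intro E _ f p hp
    rw [eLpNorm_eq_lintegral_rpow_enorm_toReal (by simpa using hp) ENNReal.ofReal_ne_top,
      ENNReal.toReal_ofReal hp.le]
  rw [key _ _ hr', key _ _ hq, key _ _ hq, key _ _ hr]
  have hH := ENNReal.lintegral_prod_norm_pow_le (μ := μ) Finset.univ
    (f := ![fun x => ‖u x‖ₑ ^ q, fun x => ‖v x‖ₑ ^ q, fun x => ‖w x‖ₑ ^ r])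
    (p := ![r' / q, τ * r' / q, r' / r])
    (by
      intro i _
      fin_cases i
      exacts [hu.enorm.pow_const q, hv.enorm.pow_const q, hw.enorm.pow_const r])
    (by
      have h2 : r' * (1 / q + τ / q + 1 / r) = 1 := by rw [h]; field_simp
      simp only [Fin.sum_univ_three, Matrix.cons_val]
      rw [← h2]
      ring)
    (by
      intro i _
      fin_cases i <;> simp <;> positivity)
  simp only [Fin.prod_univ_three, Matrix.cons_val] at hH
  have hpt : ∀ x, ‖(u x : ℂ) * ((‖v x‖ ^ τ : ℝ) : ℂ) * w x‖ₑ ^ r'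
      = (‖u x‖ₑ ^ q) ^ (r' / q) * (‖v x‖ₑ ^ q) ^ (τ * r' / q) * (‖w x‖ₑ ^ r) ^ (r' / r) := by
    intro x
    have h1 : ‖((‖v x‖ ^ τ : ℝ) : ℂ)‖ₑ = ‖v x‖ₑ ^ τ := by
      rw [← ofReal_norm, ← ofReal_norm, ENNReal.ofReal_rpow_of_nonneg (norm_nonneg _) hτ,
        Complex.norm_real, Real.norm_of_nonneg (by positivity)]
    have h2 : ‖(u x : ℂ)‖ₑ = ‖u x‖ₑ := by
      rw [← ofReal_norm, ← ofReal_norm, Complex.norm_real]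
    rw [enorm_mul, enorm_mul, h1, h2, ENNReal.mul_rpow_of_nonneg _ _ hr'.le,
      ENNReal.mul_rpow_of_nonneg _ _ hr'.le]
    simp only [← ENNReal.rpow_mul]
    congr 3 <;> field_simp
  simp_rw [hpt]
  calc _ ≤ _ := ENNReal.rpow_le_rpow hH (by positivity)
    _ = _ := by
      rw [ENNReal.mul_rpow_of_nonneg _ _ (by positivity),
        ENNReal.mul_rpow_of_nonneg _ _ (by positivity)]
      simp only [← ENNReal.rpow_mul]
      rw [show r' / q * (1 / r') = 1 / q by field_simp,
        show τ * r' / q * (1 / r') = 1 / q * τ by field_simp,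
        show r' / r * (1 / r') = 1 / r by field_simp]

lemma trilinear_bound {N : ℕ} {α σ q r r' s s' : ℝ} (hα : 0 < α) (hσ : 1 ≤ σ) (hq : 0 < q)
    (hr : 0 < r) (hr' : 0 < r') (hs : s'.HolderConjugate s)
    (hqr : 1 / q + (σ - 1) / q + 1 / r = 1 / r') (hSq : Sobolev N q) (hSs : Sobolev N s)
    (hSσ : Sobolev N (s' * (σ + 1))) :
    ∃ C : ℝ, 0 < C ∧
      ∀ (v : SchwartzMap (𝔼 N) ℂ) (u : SchwartzMap (𝔼 N) ℝ),
        (∀ x, u x - α ^ 2 * lap N (fun y => u y) x = ‖v x‖ ^ (σ + 1)) →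
        ∀ v₁ v₂ : SchwartzMap (𝔼 N) ℂ,
          LpN N (fun x => (u x : ℂ) * ((‖v x‖ ^ (σ - 1) : ℝ) : ℂ) * (v₁ x - v₂ x)) r'
            ≤ C * (H1norm N (fun y => v y)) ^ (2 * σ) * LpN N (fun x => v₁ x - v₂ x) r := by
  obtain ⟨A, hA0, hAv, hAu⟩ := hSq.real
  obtain ⟨B, hB0, -, hBu⟩ := hSs.real
  obtain ⟨D, hD0, hDv, -⟩ := hSσ.real
  have hm : 0 < min 1 (α ^ 2) := by positivity
  set K := A * (2 / min 1 (α ^ 2) * B * D ^ (σ + 1)) * A ^ (σ - 1) with hK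
  have hK0 : 0 ≤ K := by positivity
  refine ⟨K + 1, by positivity, fun v u huv v₁ v₂ => ?_⟩
  have hs'0 : 0 < s' := hs.pos
  have hσ0 : 0 < σ + 1 := by linarith
  have hσ1 : 0 ≤ σ - 1 := by linarith
  set g : 𝔼 N → ℝ := fun x => ‖v x‖ ^ (σ + 1)
  have hgc : Continuous g := v.continuous.norm.rpow_const fun _ => Or.inr hσ0.le
  have hgn : eLpNorm g (ENNReal.ofReal s') volume
      = eLpNorm v (ENNReal.ofReal (s' * (σ + 1))) volume ^ (σ + 1) := by
    rw [ENNReal.ofReal_mul hs'0.le]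
    exact eLpNorm_norm_rpow v hσ0
  have hg : MemLp g (ENNReal.ofReal s') volume := by
    refine ⟨hgc.aestronglyMeasurable, ?_⟩
    rw [hgn]
    exact ENNReal.rpow_lt_top_of_nonneg hσ0.le (v.memLp _ volume).eLpNorm_ne_top
  have hH0 : 0 ≤ H1norm N v := Real.sqrt_nonneg _
  change _ ≤ (K + 1) * (H1norm N v) ^ (2 * σ) * _
  set H := H1norm N v
  have hgL : LpN N g s' ≤ (D * H) ^ (σ + 1) := by
    rw [LpN, hgn, ← ENNReal.toReal_rpow]
    exact Real.rpow_le_rpow ENNReal.toReal_nonneg (hDv v) hσ0.le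
  have hu : LpN N u q ≤ A * (2 / min 1 (α ^ 2) * B * (D * H) ^ (σ + 1)) := by
    refine (hAu u).trans ?_
    gcongr
    refine (sobNorm_le_of_helmholtz hα hs hB0 (hBu u) hg huv).trans ?_
    gcongr
  have hw : MemLp (fun x => v₁ x - v₂ x) (ENNReal.ofReal r) volume :=
    (v₁.memLp _ volume).sub (v₂.memLp _ volume)
  have hvp : eLpNorm v (ENNReal.ofReal q) volume ^ (σ - 1) ≠ ∞ :=
    (ENNReal.rpow_lt_top_of_nonneg hσ1 (v.memLp _ volume).eLpNorm_ne_top).ne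
  have hL := ENNReal.toReal_mono
    (ENNReal.mul_ne_top (ENNReal.mul_ne_top (u.memLp _ volume).eLpNorm_ne_top hvp)
      hw.eLpNorm_ne_top)
    (eLpNorm_mul_rpow_mul_le (u.memLp (ENNReal.ofReal q) volume).1
      (v.memLp (ENNReal.ofReal q) volume).1 hw.1 hq hr hr' hσ1 hqr)
  rw [ENNReal.toReal_mul, ENNReal.toReal_mul, ← ENNReal.toReal_rpow] at hL
  have hW0 : 0 ≤ LpN N (fun x => v₁ x - v₂ x) r := ENNReal.toReal_nonneg
  calc _ ≤ LpN N u q * LpN N v q ^ (σ - 1) * LpN N (fun x => v₁ x - v₂ x) r := hL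
    _ ≤ A * (2 / min 1 (α ^ 2) * B * (D * H) ^ (σ + 1)) * (A * H) ^ (σ - 1)
          * LpN N (fun x => v₁ x - v₂ x) r := by
        have hv0 : 0 ≤ LpN N v q := ENNReal.toReal_nonneg
        gcongr
        exact hAv v
    _ = K * H ^ (2 * σ) * LpN N (fun x => v₁ x - v₂ x) r := by
        rw [Real.mul_rpow hD0 hH0, Real.mul_rpow hA0 hH0, hK,
          show 2 * σ = (σ + 1) + (σ - 1) by ring, Real.rpow_add_of_nonneg hH0 hσ0.le hσ1]
        ring
    _ ≤ _ := by
        gcongr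
        linarith

/-- (Lemma 4, first estimate) estimate for
`‖B(|v|^{σ+1})|v|^{σ-1}(v₁-v₂)‖_{r'} ≤ C_α ‖v‖_{H¹}^{2σ} ‖v₁-v₂‖_r`,
where `u = B(|v|^{σ+1})` solves the Helmholtz equation `u - α²Δu = |v|^{σ+1}`. -/
theorem stmt4 (N : ℕ) (hN : 1 ≤ N) (α : ℝ) (hα : 0 < α) (σ : ℝ) (hσ : 1 ≤ σ)
    (hσ' : 2 < N → σ < 4 / ((N : ℝ) - 2)) :
    ∃ r r' : ℝ, 2 < r ∧ (2 < N → r ≤ 2 * N / ((N : ℝ) - 2)) ∧ (N ≤ 2 → r ≤ 4) ∧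
      1 / r + 1 / r' = 1 ∧
      ∃ C : ℝ, 0 < C ∧
        ∀ (v : SchwartzMap (EuclideanSpace ℝ (Fin N)) ℂ)
          (u : SchwartzMap (EuclideanSpace ℝ (Fin N)) ℝ),
          (∀ x, u x - α ^ 2 * lap N (fun y => u y) x = ‖v x‖ ^ (σ + 1)) →
          ∀ (v₁ v₂ : SchwartzMap (EuclideanSpace ℝ (Fin N)) ℂ),
            LpN N (fun x =>
                (u x : ℂ) * ((‖v x‖ ^ (σ - 1) : ℝ) : ℂ) * (v₁ x - v₂ x)) r'
              ≤ C * (H1norm N (fun y => v y)) ^ (2 * σ) *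
                  LpN N (fun x => v₁ x - v₂ x) r := by
  have hσ0 : 0 < σ := by linarith
  by_cases hN2 : N ≤ 2
  · refine ⟨4, 4 / 3, by norm_num, fun h => by omega, fun _ => le_rfl, by norm_num,
      trilinear_bound (q := 2 * σ) (s := 2) (s' := 2) hα hσ (by positivity) (by norm_num)
        (by norm_num) ⟨by norm_num, by norm_num, by norm_num⟩ ?_
        (sobolev_of_dim_le_two hN hN2 (by linarith)) (sobolev_of_dim_le_two hN hN2 le_rfl)
        (sobolev_of_dim_le_two hN hN2 (by linarith))⟩
    field_simp
    ring
  · push Not at hN2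
    have hN' : (3 : ℝ) ≤ N := by exact_mod_cast hN2
    have hσN := hσ' hN2
    have hd : 0 < (N : ℝ) - 2 := by linarith
    rw [lt_div_iff₀ hd] at hσN
    have ht : 0 < 2 * N - σ * ((N : ℝ) - 2) := by linarith
    have ht' : 0 < 2 * N + σ * ((N : ℝ) - 2) := by positivity
    have hpos : 0 < σ * ((N : ℝ) - 2) := by positivity
    have hcrit : 2 ≤ 2 * N / ((N : ℝ) - 2) := by
      rw [le_div_iff₀ hd]
      linarith
    refine ⟨4 * N / (2 * N - σ * (N - 2)), 4 * N / (2 * N + σ * (N - 2)), ?_, fun _ => ?_,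
      fun h => by omega, ?_,
      trilinear_bound (q := 2 * N / (N - 2)) (s := 2 * N / (N - 2)) (s' := 2 * N / (N + 2)) hα hσ
        (by positivity) (by positivity) (by positivity) ⟨?_, by positivity, by positivity⟩ ?_
        (sobolev_of_le_critical hN2 hcrit le_rfl) (sobolev_of_le_critical hN2 hcrit le_rfl)
        (sobolev_of_le_critical hN2 ?_ ?_)⟩
    · rw [lt_div_iff₀ ht]
      linarith
    · rw [div_le_div_iff₀ ht hd]
      nlinarith
    · field_simp
      ring
    · field_simp
      ring
    · field_simp
      ring
    · rw [div_mul_eq_mul_div, le_div_iff₀ (by positivity)]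
      nlinarith
    · rw [div_mul_eq_mul_div, div_le_div_iff₀ (by positivity) hd]
      nlinarith
end
end

section
/- Let N ≥ 1, α > 0, and let 1 ≤ σ < 4/(N−2) (interpreted as σ ≥ 1 arbitrary when N ≤ 2). Then there exists an exponent r with 2 < r ≤ 2N/(N−2) (interpreted as 2 < r ≤ 4 when N ≤ 2) and a constant C_α > 0, depending only on N, σ, α, such that: for every Schwartz function v : ℝ^N → ℂ and every Schwartz function u : ℝ^N → ℝ satisfying u − α²Δu = |v|^{σ+1} pointwise on ℝ^N, and for all Schwartz functions v₁, v₂ : ℝ^N → ℂ, one has ‖u · |v|^{σ−3} v² · (v₁ − v₂)‖_{L^{r'}} ≤ C_α ‖v‖_{H¹}^{2σ} ‖v₁ − v₂‖_{L^r}, where 1/r + 1/r' = 1, and where the factor |v|^{σ−3} v² is interpreted as 0 at points where v = 0. -/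
open MeasureTheory Real Set
open scoped ENNReal NNReal ComplexConjugate

noncomputable section

open Filter Topology

section Cutoff

variable {E F : Type*} [NormedAddCommGroup E] [InnerProductSpace ℝ E] [FiniteDimensional ℝ E]
  [NormedAddCommGroup F] [NormedSpace ℝ F]

/-- A sequence of smooth compactly supported cutoff functions with uniformly bounded derivatives
that converges pointwise to `1`. -/
theorem exists_cutoff_seq (E : Type*) [NormedAddCommGroup E] [InnerProductSpace ℝ E]
    [FiniteDimensional ℝ E] :
    ∃ (χ : ℕ → E → ℝ) (M : ℝ≥0), (∀ n, ContDiff ℝ 1 (χ n)) ∧ (∀ n, HasCompactSupport (χ n)) ∧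
      (∀ n x, ‖χ n x‖ ≤ 1) ∧ (∀ n x, ‖fderiv ℝ (χ n) x‖ ≤ M) ∧
      ∀ x, Tendsto (fun n => χ n x) atTop (𝓝 1) := by
  let φ : ContDiffBump (0 : E) := ⟨1, 2, one_pos, one_lt_two⟩
  have hφ : ContDiff ℝ 1 φ := φ.contDiff
  obtain ⟨M, hM⟩ := (φ.hasCompactSupport.fderiv (𝕜 := ℝ)).exists_bound_of_continuous
    (hφ.continuous_fderiv one_ne_zero)
  have hM0 : 0 ≤ M := (norm_nonneg _).trans (hM 0)
  have hc : ∀ n : ℕ, ((n : ℝ) + 1)⁻¹ ≠ 0 := fun n => by positivity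
  refine ⟨fun n x => φ (((n : ℝ) + 1)⁻¹ • x), ⟨M, hM0⟩, fun n => ?_, fun n => ?_, fun n x => ?_,
    fun n x => ?_, fun x => ?_⟩
  · exact hφ.comp (contDiff_const_smul _)
  · exact φ.hasCompactSupport.comp_smul (hc n)
  · rw [Real.norm_of_nonneg φ.nonneg]
    exact φ.le_one
  · have h := fderiv_comp_smul (𝕜 := ℝ) (f := (φ : E → ℝ)) (x := x) ((n : ℝ) + 1)⁻¹
    rw [h, norm_smul]
    have h1 : ‖((n : ℝ) + 1)⁻¹‖ ≤ 1 := by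
      rw [Real.norm_of_nonneg (by positivity)]
      exact inv_le_one_of_one_le₀ (by linarith [n.cast_nonneg (α := ℝ)])
    calc _ ≤ 1 * M := mul_le_mul h1 (hM _) (norm_nonneg _) zero_le_one
      _ = M := one_mul _
  · have h0 : Tendsto (fun n : ℕ => ((n : ℝ) + 1)⁻¹ • x) atTop (𝓝 0) := by
      have := (tendsto_one_div_add_atTop_nhds_zero_nat (𝕜 := ℝ)).smul_const x
      simpa using this
    have h1 : φ 0 = 1 := φ.one_of_mem_closedBall (by simp [φ])
    have h2 := (hφ.continuous.tendsto 0).comp h0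
    rw [h1] at h2
    exact h2

variable [MeasurableSpace E] [BorelSpace E]

/-- A Sobolev-type inequality for compactly supported `C¹` functions extends to all `C¹` functions
at the price of a lower-order term. -/
theorem exists_eLpNorm_le_of_hasCompactSupport {μ : Measure E} {p q : ℝ≥0∞} (hp : 1 ≤ p)
    {K : ℝ≥0∞} (hK : ∀ w : E → F, ContDiff ℝ 1 w → HasCompactSupport w →
      eLpNorm w q μ ≤ K * eLpNorm (fderiv ℝ w) p μ) :
    ∃ M : ℝ≥0, ∀ w : E → F, ContDiff ℝ 1 w →
      eLpNorm w q μ ≤ K * (eLpNorm (fderiv ℝ w) p μ + M * eLpNorm w p μ) := by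
  obtain ⟨χ, M, hχ, hχc, hχ1, hχM, hχt⟩ := exists_cutoff_seq E
  refine ⟨M, fun w hw => ?_⟩
  have hcd : ∀ n, ContDiff ℝ 1 (fun x => χ n x • w x) := fun n => (hχ n).smul hw
  refine Lp.eLpNorm_le_of_ae_tendsto (u := atTop) (f := fun n x => χ n x • w x)
    (Eventually.of_forall fun n => ?_) (fun n => (hcd n).continuous.aestronglyMeasurable)
    (Eventually.of_forall fun x => ?_)
  · refine (hK _ (hcd n) ((hχc n).smul_right)).trans ?_
    gcongr
    have hfd : fderiv ℝ (fun x => χ n x • w x) =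
        (fun x => χ n x • fderiv ℝ w x) + fun x => (fderiv ℝ (χ n) x).smulRight (w x) := by
      funext x
      have h1 : DifferentiableAt ℝ (χ n) x := (hχ n).differentiable one_ne_zero x
      have h2 : DifferentiableAt ℝ w x := hw.differentiable one_ne_zero x
      rw [fderiv_fun_smul h1 h2, Pi.add_apply]
    have hwf := hw.continuous_fderiv one_ne_zero
    have hχf := (hχ n).continuous_fderiv one_ne_zero
    have hA : AEStronglyMeasurable (fun x => χ n x • fderiv ℝ w x) μ :=
      ((hχ n).continuous.smul hwf).aestronglyMeasurable
    have hB : AEStronglyMeasurable (fun x => (fderiv ℝ (χ n) x).smulRight (w x)) μ := by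
      have : Continuous fun x => (fderiv ℝ (χ n) x).smulRight (w x) :=
        (isBoundedBilinearMap_smulRight (𝕜 := ℝ) (E := E) (F := F)).continuous.comp
          (hχf.prodMk hw.continuous)
      exact this.aestronglyMeasurable
    rw [hfd]
    refine (eLpNorm_add_le hA hB hp).trans ?_
    gcongr
    · refine eLpNorm_mono fun x => ?_
      rw [norm_smul]
      exact mul_le_of_le_one_left (norm_nonneg _) (hχ1 n x)
    · have hle : ∀ᵐ x ∂μ, ‖(fderiv ℝ (χ n) x).smulRight (w x)‖₊ ≤ M * ‖w x‖₊ := by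
        refine Eventually.of_forall fun x => ?_
        rw [ContinuousLinearMap.nnnorm_smulRight_apply]
        gcongr
        exact hχM n x
      exact eLpNorm_le_nnreal_smul_eLpNorm_of_ae_le_mul hle p
  · simpa using (hχt x).smul_const (w x)

end Cutoff

section Sobolev

/-- The Sobolev inequality `W^{1,1}(ℝ) ⊆ L^∞(ℝ)`. -/
theorem eLpNorm_top_le_eLpNorm_fderiv_one {F : Type*} [NormedAddCommGroup F] [NormedSpace ℝ F]
    {w : EuclideanSpace ℝ (Fin 1) → F} (hw : ContDiff ℝ 1 w) (hwc : HasCompactSupport w) :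
    eLpNorm w ∞ volume ≤ eLpNorm (fderiv ℝ w) 1 volume := by
  let e : ℝ ≃ₗᵢ[ℝ] EuclideanSpace ℝ (Fin 1) := (OrthonormalBasis.singleton (Fin 1) ℝ).repr
  have he : MeasurePreserving e := e.measurePreserving
  have hwe : ContDiff ℝ 1 (w ∘ e) := hw.comp e.contDiff
  have hwec : HasCompactSupport (w ∘ e) := hwc.comp_homeomorph e.toHomeomorph
  rw [eLpNorm_exponent_top, eLpNorm_one_eq_lintegral_enorm]
  refine eLpNormEssSup_le_of_ae_enorm_bound (Filter.Eventually.of_forall fun x => ?_)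
  have h1 := hwec.enorm_le_lintegral_Ici_deriv hwe (e.symm x)
  rw [Function.comp_apply, e.apply_symm_apply] at h1
  refine h1.trans ((setLIntegral_le_lintegral _ _).trans ?_)
  have hc : Continuous fun y => ‖fderiv ℝ w y‖ₑ := (hw.continuous_fderiv one_ne_zero).enorm
  rw [← he.lintegral_comp hc.measurable]
  refine lintegral_mono fun t => ?_
  have h2 : deriv (w ∘ e) t = fderiv ℝ w (e t) (e 1) := by
    have h3 : HasFDerivAt (w ∘ e) _ t :=
      (hw.differentiable one_ne_zero (e t)).hasFDerivAt.comp t e.hasFDerivAt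
    rw [h3.hasDerivAt.deriv]
    rfl
  rw [h2]
  refine (ContinuousLinearMap.le_opENorm _ _).trans (le_of_eq ?_)
  have h4 : ‖e (1 : ℝ)‖ₑ = 1 := by
    rw [e.enorm_map]
    simp
  rw [h4, mul_one]

theorem eLpNorm_rpow_eq_lintegral {X F : Type*} [MeasurableSpace X] [NormedAddCommGroup F]
    {μ : Measure X} {p : ℝ} (hp : 0 < p) (f : X → F) :
    eLpNorm f (ENNReal.ofReal p) μ ^ p = ∫⁻ x, ‖f x‖ₑ ^ p ∂μ := by
  rw [eLpNorm_eq_lintegral_rpow_enorm_toReal (by simpa using hp) ENNReal.ofReal_ne_top,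
    ENNReal.toReal_ofReal hp.le, ← ENNReal.rpow_mul, one_div_mul_cancel hp.ne', ENNReal.rpow_one]

theorem eLpNorm_two_rpow_eq_lintegral {X F : Type*} [MeasurableSpace X] [NormedAddCommGroup F]
    {μ : Measure X} (f : X → F) :
    eLpNorm f 2 μ ^ (2 : ℝ) = ∫⁻ x, ‖f x‖ₑ ^ (2 : ℝ) ∂μ := by
  simpa using eLpNorm_rpow_eq_lintegral (μ := μ) (p := 2) two_pos f

/-- In dimension one and two, `W^{1,1}` embeds into `L²`. -/
theorem exists_eLpNorm_two_le_of_le_two {N : ℕ} (hN : 1 ≤ N) (hN2 : N ≤ 2) :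
    ∃ C : ℝ≥0, ∀ w : EuclideanSpace ℝ (Fin N) → ℂ, ContDiff ℝ 1 w →
      eLpNorm w 2 volume ≤ C * (eLpNorm (fderiv ℝ w) 1 volume + eLpNorm w 1 volume) := by
  interval_cases N
  · obtain ⟨M, hM⟩ := exists_eLpNorm_le_of_hasCompactSupport (μ := volume) (p := 1) (q := ∞)
      (F := ℂ) (K := 1) le_rfl fun w hw hwc => by
        rw [one_mul]
        exact eLpNorm_top_le_eLpNorm_fderiv_one hw hwc
    refine ⟨M + 1, fun w hw => ?_⟩
    have hMw := hM w hw
    set A := eLpNorm (fderiv ℝ w) 1 volume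
    set B := eLpNorm w 1 volume with hB
    have h1 : ∫⁻ x, ‖w x‖ₑ ^ (2 : ℝ) ≤ eLpNorm w ∞ volume * B := by
      rw [hB, eLpNorm_one_eq_lintegral_enorm,
        ← lintegral_const_mul _ hw.continuous.enorm.measurable, eLpNorm_exponent_top]
      refine lintegral_mono_ae ?_
      filter_upwards [enorm_ae_le_eLpNormEssSup w volume] with x hx
      rw [ENNReal.rpow_two, sq]
      gcongr
    rw [← eLpNorm_two_rpow_eq_lintegral] at h1
    rw [← ENNReal.rpow_le_rpow_iff (two_pos : (0 : ℝ) < 2)]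
    refine h1.trans ?_
    rw [ENNReal.rpow_two, sq]
    have hM1 : (1 : ℝ≥0∞) ≤ ((M + 1 : ℝ≥0) : ℝ≥0∞) := by exact_mod_cast le_add_self
    have hM2 : (M : ℝ≥0∞) ≤ ((M + 1 : ℝ≥0) : ℝ≥0∞) := by exact_mod_cast le_self_add
    refine mul_le_mul' (hMw.trans ?_) ?_
    · rw [one_mul, mul_add]
      gcongr
      exact le_mul_of_one_le_left' hM1
    · exact le_trans le_add_self (le_mul_of_one_le_left' hM1)
  · have hc : NNReal.HolderConjugate (Module.finrank ℝ (EuclideanSpace ℝ (Fin 2))) 2 := by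
      rw [finrank_euclideanSpace_fin, NNReal.holderConjugate_iff]
      norm_num
    obtain ⟨M, hM⟩ := exists_eLpNorm_le_of_hasCompactSupport
      (μ := (volume : Measure (EuclideanSpace ℝ (Fin 2)))) (p := 1) (q := ((2 : ℝ≥0) : ℝ≥0∞))
      (F := ℂ) le_rfl fun w hw hwc => eLpNorm_le_eLpNorm_fderiv_one volume hw hwc hc
    refine ⟨eLpNormLESNormFDerivOneConst
      (volume : Measure (EuclideanSpace ℝ (Fin 2))) (2 : ℝ≥0) * (1 + M), fun w hw => ?_⟩
    have hM1 : (M : ℝ≥0∞) ≤ ((1 + M : ℝ≥0) : ℝ≥0∞) := by exact_mod_cast le_add_self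
    have hM2 : (1 : ℝ≥0∞) ≤ ((1 + M : ℝ≥0) : ℝ≥0∞) := by exact_mod_cast le_self_add
    refine (hM w hw).trans ?_
    rw [ENNReal.coe_mul, mul_assoc]
    refine mul_le_mul_right ?_ _
    rw [mul_add]
    gcongr
    exact le_mul_of_one_le_left' hM2

/-- The `H¹` norm, with values in `[0, ∞]` (up to equivalence of norms). -/
def sobolevNorm {N : ℕ} {F : Type*} [NormedAddCommGroup F] [NormedSpace ℝ F]
    (v : EuclideanSpace ℝ (Fin N) → F) : ℝ≥0∞ :=
  eLpNorm v 2 volume + eLpNorm (fderiv ℝ v) 2 volume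

/-- The continuous embedding `H¹(ℝ^N) ⊆ L^s(ℝ^N)`. -/
def SobolevEmbedding (N : ℕ) (s : ℝ) : Prop :=
  ∃ C : ℝ≥0, ∀ v : EuclideanSpace ℝ (Fin N) → ℂ, ContDiff ℝ 1 v →
    ∫⁻ x, ‖v x‖ₑ ^ s ≤ C * sobolevNorm v ^ s

theorem lintegral_sq_le_sobolevNorm {N : ℕ} {F : Type*} [NormedAddCommGroup F] [NormedSpace ℝ F]
    (v : EuclideanSpace ℝ (Fin N) → F) :
    ∫⁻ x, ‖v x‖ₑ ^ (2 : ℝ) ≤ sobolevNorm v ^ (2 : ℝ) := by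
  rw [← eLpNorm_two_rpow_eq_lintegral]
  gcongr
  exact le_self_add

theorem SobolevEmbedding.two (N : ℕ) : SobolevEmbedding N 2 :=
  ⟨1, fun v _ => by
    rw [ENNReal.coe_one, one_mul]
    exact lintegral_sq_le_sobolevNorm v⟩

/-- Interpolation between `L²` and `L^s`. -/
theorem SobolevEmbedding.mono {N : ℕ} {s t : ℝ} (h : SobolevEmbedding N s) (h2 : 2 ≤ t)
    (hts : t ≤ s) : SobolevEmbedding N t := by
  rcases eq_or_lt_of_le (h2.trans hts) with rfl | hs
  · rwa [le_antisymm hts h2]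
  obtain ⟨C, hC⟩ := h
  have hs2 : 0 < s - 2 := by linarith
  set q := (t - 2) / (s - 2) with hq
  have hq0 : 0 ≤ q := div_nonneg (by linarith) hs2.le
  have hq1 : q ≤ 1 := (div_le_one hs2).2 (by linarith)
  have hexp : 2 * (1 - q) + s * q = t := by
    have : q * (s - 2) = t - 2 := div_mul_cancel₀ _ hs2.ne'
    linarith
  refine ⟨C ^ q, fun v hv => ?_⟩
  calc ∫⁻ x, ‖v x‖ₑ ^ t
      = ∫⁻ x, (‖v x‖ₑ ^ (2 : ℝ)) ^ (1 - q) * (‖v x‖ₑ ^ s) ^ q := by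
        refine lintegral_congr fun x => ?_
        rw [← ENNReal.rpow_mul, ← ENNReal.rpow_mul, ← ENNReal.rpow_add_of_nonneg, hexp]
        · exact mul_nonneg zero_le_two (by linarith)
        · exact mul_nonneg (by linarith) hq0
    _ ≤ (∫⁻ x, ‖v x‖ₑ ^ (2 : ℝ)) ^ (1 - q) * (∫⁻ x, ‖v x‖ₑ ^ s) ^ q :=
        ENNReal.lintegral_mul_norm_pow_le (hv.continuous.enorm.measurable.pow_const _).aemeasurable
          (hv.continuous.enorm.measurable.pow_const _).aemeasurable (by linarith) hq0 (by ring)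
    _ ≤ (sobolevNorm v ^ (2 : ℝ)) ^ (1 - q) * (C * sobolevNorm v ^ s) ^ q := by
        gcongr
        · exact lintegral_sq_le_sobolevNorm v
        · exact hC v hv
    _ = _ := by
        rw [ENNReal.mul_rpow_of_nonneg _ _ hq0, ← ENNReal.rpow_mul, ← ENNReal.rpow_mul,
          mul_left_comm, ← ENNReal.rpow_add_of_nonneg, hexp, ENNReal.coe_rpow_of_nonneg _ hq0]
        · exact mul_nonneg zero_le_two (by linarith)
        · exact mul_nonneg (by linarith) hq0

theorem sobolevEmbedding_critical {N : ℕ} (hN : 2 < N) :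
    SobolevEmbedding N (2 * N / ((N : ℝ) - 2)) := by
  have hN' : (2 : ℝ) < N := by exact_mod_cast hN
  set s : ℝ := 2 * N / ((N : ℝ) - 2) with hs
  have hs0 : 0 < s := div_pos (by positivity) (by linarith)
  have hE : Module.finrank ℝ (EuclideanSpace ℝ (Fin N)) = N := finrank_euclideanSpace_fin
  have hexp : ((s.toNNReal : ℝ≥0) : ℝ)⁻¹ = ((2 : ℝ≥0) : ℝ)⁻¹ -
      (Module.finrank ℝ (EuclideanSpace ℝ (Fin N)) : ℝ)⁻¹ := by
    rw [hE, Real.coe_toNNReal _ hs0.le, hs]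
    have : (N : ℝ) - 2 ≠ 0 := by linarith
    push_cast
    field_simp
  obtain ⟨M, hM⟩ := exists_eLpNorm_le_of_hasCompactSupport
    (μ := (volume : Measure (EuclideanSpace ℝ (Fin N)))) (p := ((2 : ℝ≥0) : ℝ≥0∞))
    (q := ((s.toNNReal : ℝ≥0) : ℝ≥0∞)) (F := ℂ) (by norm_num) fun w hw hwc =>
      eLpNorm_le_eLpNorm_fderiv_of_eq volume hw hwc one_le_two (by omega) hexp
  set K := SNormLESNormFDerivOfEqConst ℂ (volume : Measure (EuclideanSpace ℝ (Fin N)))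
    ((2 : ℝ≥0) : ℝ)
  refine ⟨(K * (1 + M)) ^ s, fun v hv => ?_⟩
  have hM1 : (M : ℝ≥0∞) ≤ ((1 + M : ℝ≥0) : ℝ≥0∞) := by exact_mod_cast le_add_self
  have hM2 : (1 : ℝ≥0∞) ≤ ((1 + M : ℝ≥0) : ℝ≥0∞) := by exact_mod_cast le_self_add
  rw [← eLpNorm_rpow_eq_lintegral hs0, ENNReal.coe_rpow_of_nonneg _ hs0.le,
    ← ENNReal.mul_rpow_of_nonneg _ _ hs0.le]
  gcongr
  refine (hM v hv).trans ?_
  rw [ENNReal.coe_mul, mul_assoc]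
  refine mul_le_mul_right ?_ _
  rw [sobolevNorm, mul_add, add_comm, ENNReal.coe_ofNat]
  gcongr
  exact le_mul_of_one_le_left' hM2

theorem lintegral_mul_le_eLpNorm_two_mul {X F G : Type*} [MeasurableSpace X] [NormedAddCommGroup F]
    [NormedAddCommGroup G] {μ : Measure X} {f : X → F} {g : X → G}
    (hf : AEMeasurable (fun x => ‖f x‖ₑ) μ) (hg : AEMeasurable (fun x => ‖g x‖ₑ) μ) :
    ∫⁻ x, ‖f x‖ₑ * ‖g x‖ₑ ∂μ ≤ eLpNorm f 2 μ * eLpNorm g 2 μ := by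
  have h := ENNReal.lintegral_mul_le_Lp_mul_Lq μ Real.HolderConjugate.two_two hf hg
  rw [← eLpNorm_two_rpow_eq_lintegral, ← eLpNorm_two_rpow_eq_lintegral, ← ENNReal.rpow_mul,
    ← ENNReal.rpow_mul] at h
  simpa using h

theorem exists_eLpNorm_pow_le_of_le_two {N : ℕ} (hN : 1 ≤ N) (hN2 : N ≤ 2) (k : ℕ) :
    ∃ C : ℝ≥0, ∀ v : EuclideanSpace ℝ (Fin N) → ℂ, ContDiff ℝ 1 v →
      eLpNorm (fun x => v x ^ (k + 1)) 2 volume ≤ C * sobolevNorm v ^ (k + 1) := by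
  induction k with
  | zero =>
    refine ⟨1, fun v _ => ?_⟩
    simp [sobolevNorm]
  | succ k ih =>
    obtain ⟨C, hC⟩ := ih
    obtain ⟨D, hD⟩ := exists_eLpNorm_two_le_of_le_two hN hN2
    refine ⟨D * ((k + 2) * C), fun v hv => ?_⟩
    refine (hD _ (hv.pow (k + 1 + 1))).trans ?_
    rw [ENNReal.coe_mul, mul_assoc]
    gcongr
    have hvf := hv.continuous_fderiv one_ne_zero
    have hpow : Continuous fun x => v x ^ (k + 1) := hv.continuous.pow _
    have h1 : eLpNorm (fderiv ℝ fun x => v x ^ (k + 1 + 1)) 1 volume ≤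
        (k + 2) * (eLpNorm (fun x => v x ^ (k + 1)) 2 volume * eLpNorm (fderiv ℝ v) 2 volume) := by
      rw [eLpNorm_one_eq_lintegral_enorm]
      refine le_trans ?_ (mul_le_mul_right (lintegral_mul_le_eLpNorm_two_mul
        hpow.enorm.measurable.aemeasurable hvf.enorm.measurable.aemeasurable) _)
      have hm : Measurable fun x => ‖v x ^ (k + 1)‖ₑ * ‖fderiv ℝ v x‖ₑ :=
        hpow.enorm.measurable.mul hvf.enorm.measurable
      rw [← lintegral_const_mul _ hm]
      refine lintegral_mono fun x => le_of_eq ?_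
      rw [((hv.differentiable one_ne_zero x).hasFDerivAt.pow (k + 1 + 1)).fderiv, enorm_smul]
      have hn : ‖((k + 1 + 1 : ℕ) : ℂ)‖ₑ = (k : ℝ≥0∞) + 2 := by
        rw [← ofReal_norm, Complex.norm_natCast, ENNReal.ofReal_natCast]
        push_cast
        ring
      rw [nsmul_eq_mul, enorm_mul, hn, add_tsub_cancel_right, mul_assoc]
    have h2 : eLpNorm (fun x => v x ^ (k + 1 + 1)) 1 volume ≤
        (k + 2) * (eLpNorm (fun x => v x ^ (k + 1)) 2 volume * eLpNorm v 2 volume) := by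
      rw [eLpNorm_one_eq_lintegral_enorm]
      refine le_trans ?_ (le_mul_of_one_le_left' (by norm_cast; omega))
      refine le_trans ?_ (lintegral_mul_le_eLpNorm_two_mul
        hpow.enorm.measurable.aemeasurable hv.continuous.enorm.measurable.aemeasurable)
      refine lintegral_mono fun x => ?_
      rw [pow_succ, enorm_mul]
    calc _ ≤ (k + 2) * (eLpNorm (fun x => v x ^ (k + 1)) 2 volume * sobolevNorm v) := by
          rw [sobolevNorm, mul_add, mul_add, add_comm]
          exact add_le_add h2 h1
      _ ≤ (k + 2) * (C * sobolevNorm v ^ (k + 1) * sobolevNorm v) := by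
          gcongr
          exact hC v hv
      _ = _ := by
          push_cast
          ring

theorem sobolevEmbedding_of_le_two {N : ℕ} (hN : 1 ≤ N) (hN2 : N ≤ 2) {s : ℝ} (hs : 2 ≤ s) :
    SobolevEmbedding N s := by
  obtain ⟨k, hk⟩ := exists_nat_ge s
  have hk2 : SobolevEmbedding N (2 * ((k : ℝ) + 1)) := by
    obtain ⟨C, hC⟩ := exists_eLpNorm_pow_le_of_le_two hN hN2 k
    refine ⟨C ^ 2, fun v hv => ?_⟩
    have h := ENNReal.rpow_le_rpow (hC v hv) zero_le_two
    rw [eLpNorm_two_rpow_eq_lintegral] at h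
    calc _ = ∫⁻ x, ‖v x ^ (k + 1)‖ₑ ^ (2 : ℝ) := by
          refine lintegral_congr fun x => ?_
          rw [enorm_pow, ← ENNReal.rpow_natCast, ← ENNReal.rpow_mul]
          push_cast
          ring_nf
      _ ≤ _ := h
      _ = _ := by
          rw [ENNReal.mul_rpow_of_nonneg _ _ zero_le_two, ← ENNReal.rpow_natCast,
            ← ENNReal.rpow_mul]
          push_cast
          rw [ENNReal.rpow_two]
          ring_nf
  exact hk2.mono hs (by linarith)

end Sobolev

section Helmholtz

open LineDeriv

variable {N : ℕ}

theorem norm_sq_eq_sum_basisVec (L : EuclideanSpace ℝ (Fin N) →L[ℝ] ℝ) :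
    ‖L‖ ^ 2 = ∑ i, L (basisVec N i) ^ 2 := by
  obtain ⟨g, rfl⟩ := (InnerProductSpace.toDual ℝ (EuclideanSpace ℝ (Fin N))).surjective L
  rw [LinearIsometryEquiv.norm_map, EuclideanSpace.norm_sq_eq]
  refine Finset.sum_congr rfl fun i _ => ?_
  simp [basisVec, EuclideanSpace.inner_single_right]

/-- The energy identity for the Helmholtz operator `u ↦ u - α²Δu`. -/
theorem integral_helmholtz_mul_self (α : ℝ) (u : SchwartzMap (EuclideanSpace ℝ (Fin N)) ℝ) :
    Integrable (fun x => u x ^ 2 + α ^ 2 * ‖fderiv ℝ u x‖ ^ 2) ∧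
    ∫ x, (u x - α ^ 2 * lap N (fun y => u y) x) * u x =
      ∫ x, (u x ^ 2 + α ^ 2 * ‖fderiv ℝ u x‖ ^ 2) := by
  have hprod : ∀ f g : SchwartzMap (EuclideanSpace ℝ (Fin N)) ℝ,
      Integrable fun x => f x * g x := fun f g => (f.memLp 2).integrable_mul (g.memLp 2)
  set D : Fin N → SchwartzMap (EuclideanSpace ℝ (Fin N)) ℝ := fun i => ∂_{basisVec N i} u with hD
  have hnorm : ∀ x, ‖fderiv ℝ u x‖ ^ 2 = ∑ i, D i x * D i x := fun x => by
    rw [norm_sq_eq_sum_basisVec]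
    exact Finset.sum_congr rfl fun i _ => sq _
  have hlap : ∀ x, lap N (fun y => u y) x = ∑ i, (∂_{basisVec N i} (D i)) x := fun x => rfl
  have hgrad : Integrable fun x => ∑ i, D i x * D i x :=
    integrable_finsetSum _ fun i _ => hprod _ _
  have hlapi : Integrable fun x => ∑ i, u x * (∂_{basisVec N i} (D i)) x :=
    integrable_finsetSum _ fun i _ => hprod _ _
  have hparts : ∫ x, ∑ i, u x * (∂_{basisVec N i} (D i)) x = - ∫ x, ∑ i, D i x * D i x := by
    rw [integral_finsetSum _ fun i _ => hprod _ _, integral_finsetSum _ fun i _ => hprod _ _,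
      ← Finset.sum_neg_distrib]
    exact Finset.sum_congr rfl fun i _ =>
      SchwartzMap.integral_mul_lineDerivOp_right_eq_neg_left u (D i) (basisVec N i)
  simp_rw [hnorm, hlap]
  have hsq : Integrable fun x => u x ^ 2 := by simpa [sq] using hprod u u
  refine ⟨hsq.add (hgrad.const_mul _), ?_⟩
  rw [integral_add hsq (hgrad.const_mul _), integral_const_mul]
  have h : ∀ x, (u x - α ^ 2 * ∑ i, (∂_{basisVec N i} (D i)) x) * u x =
      u x ^ 2 - α ^ 2 * ∑ i, u x * (∂_{basisVec N i} (D i)) x := fun x => by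
    rw [← Finset.mul_sum]
    ring
  simp_rw [h]
  rw [integral_sub hsq (hlapi.const_mul _), integral_const_mul, hparts]
  ring

theorem lintegral_energy_le {α : ℝ} {u : SchwartzMap (EuclideanSpace ℝ (Fin N)) ℝ}
    {f : EuclideanSpace ℝ (Fin N) → ℝ} (h : ∀ x, u x - α ^ 2 * lap N (fun y => u y) x = f x) :
    ENNReal.ofReal (min 1 (α ^ 2)) * sobolevNorm u ^ 2 ≤ 2 * ∫⁻ x, ‖f x‖ₑ * ‖u x‖ₑ := by
  obtain ⟨hi, hE⟩ := integral_helmholtz_mul_self α u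
  set m := ENNReal.ofReal (min 1 (α ^ 2)) with hm
  have hm1 : m ≤ 1 := by
    rw [hm, ← ENNReal.ofReal_one]
    exact ENNReal.ofReal_le_ofReal (min_le_left _ _)
  have hm2 : m ≤ ENNReal.ofReal (α ^ 2) := ENNReal.ofReal_le_ofReal (min_le_right _ _)
  have hsq : sobolevNorm u ^ 2 ≤
      2 * (eLpNorm u 2 volume ^ (2 : ℝ) + eLpNorm (fderiv ℝ u) 2 volume ^ (2 : ℝ)) := by
    have := ENNReal.rpow_add_le_mul_rpow_add_rpow (eLpNorm u 2 volume)
      (eLpNorm (fderiv ℝ u) 2 volume) one_le_two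
    rw [sobolevNorm, ← ENNReal.rpow_two]
    refine this.trans_eq ?_
    norm_num
  have hu2 : Continuous fun x => ‖u x‖ₑ := u.continuous.enorm
  calc m * sobolevNorm u ^ 2
      ≤ m * (2 * (eLpNorm u 2 volume ^ (2 : ℝ) + eLpNorm (fderiv ℝ u) 2 volume ^ (2 : ℝ))) := by
        gcongr
    _ = 2 * (m * eLpNorm u 2 volume ^ (2 : ℝ) + m * eLpNorm (fderiv ℝ u) 2 volume ^ (2 : ℝ)) := by
        ring
    _ ≤ 2 * (1 * eLpNorm u 2 volume ^ (2 : ℝ) +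
          ENNReal.ofReal (α ^ 2) * eLpNorm (fderiv ℝ u) 2 volume ^ (2 : ℝ)) := by
        gcongr
    _ = 2 * ∫⁻ x, ENNReal.ofReal (u x ^ 2 + α ^ 2 * ‖fderiv ℝ u x‖ ^ 2) := by
        rw [one_mul, eLpNorm_two_rpow_eq_lintegral, eLpNorm_two_rpow_eq_lintegral,
          ← lintegral_const_mul' _ _ ENNReal.ofReal_ne_top,
          ← lintegral_add_left (hu2.measurable.pow_const _)]
        congr 1
        refine lintegral_congr fun x => ?_
        rw [ENNReal.ofReal_add (sq_nonneg _) (by positivity), ENNReal.ofReal_mul (sq_nonneg _),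
          ENNReal.rpow_two, ENNReal.rpow_two, ← sq_abs (u x), ENNReal.ofReal_pow (abs_nonneg _),
          ENNReal.ofReal_pow (norm_nonneg _), ofReal_norm, ← Real.norm_eq_abs, ofReal_norm]
    _ = 2 * ENNReal.ofReal (∫ x, f x * u x) := by
        rw [← ofReal_integral_eq_lintegral_ofReal hi
          (Filter.Eventually.of_forall fun x => by positivity), ← hE]
        simp_rw [h]
    _ ≤ 2 * ∫⁻ x, ‖f x‖ₑ * ‖u x‖ₑ := by
        gcongr
        refine (ENNReal.ofReal_le_ofReal (le_abs_self _)).trans ?_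
        rw [← Real.norm_eq_abs, ofReal_norm]
        refine (enorm_integral_le_lintegral_enorm _).trans_eq ?_
        simp_rw [enorm_mul]

end Helmholtz

section Estimate

variable {N : ℕ}

theorem sobolevNorm_ofReal_le {u : EuclideanSpace ℝ (Fin N) → ℝ} (hu : Differentiable ℝ u) :
    sobolevNorm (fun x => (u x : ℂ)) ≤ sobolevNorm u := by
  refine add_le_add (eLpNorm_mono fun x => by simp) (eLpNorm_mono fun x => ?_)
  have h : HasFDerivAt (fun y => (u y : ℂ)) (Complex.ofRealCLM.comp (fderiv ℝ u x)) x :=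
    Complex.ofRealCLM.hasFDerivAt.comp x (hu x).hasFDerivAt
  rw [h.fderiv]
  refine (ContinuousLinearMap.opNorm_comp_le _ _).trans ?_
  simp

theorem SobolevEmbedding.exists_real {s : ℝ} (hs : 0 < s) (h : SobolevEmbedding N s) :
    ∃ C : ℝ≥0, ∀ u : EuclideanSpace ℝ (Fin N) → ℝ, ContDiff ℝ 1 u →
      ∫⁻ x, ‖u x‖ₑ ^ s ≤ C * sobolevNorm u ^ s := by
  obtain ⟨C, hC⟩ := h
  refine ⟨C, fun u hu => ?_⟩
  have h1 := hC (fun x => (u x : ℂ)) (Complex.ofRealCLM.contDiff.comp hu)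
  have h2 : ∀ x, ‖(u x : ℂ)‖ₑ = ‖u x‖ₑ := fun x => by
    rw [← ofReal_norm, ← ofReal_norm, Complex.norm_real]
  simp_rw [h2] at h1
  refine h1.trans ?_
  gcongr
  exact sobolevNorm_ofReal_le (hu.differentiable one_ne_zero)

theorem SchwartzMap.sobolevNorm_ne_top {F : Type*} [NormedAddCommGroup F] [NormedSpace ℝ F]
    (u : SchwartzMap (EuclideanSpace ℝ (Fin N)) F) : sobolevNorm u ≠ ∞ := by
  have h1 : eLpNorm u 2 volume ≠ ∞ := (u.memLp 2 volume).eLpNorm_ne_top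
  have h2 : eLpNorm (fderiv ℝ u) 2 volume ≠ ∞ := by
    have h := ((SchwartzMap.fderivCLM ℝ (EuclideanSpace ℝ (Fin N)) F u).memLp 2
      volume).eLpNorm_ne_top
    have h' : (SchwartzMap.fderivCLM ℝ (EuclideanSpace ℝ (Fin N)) F u :
        EuclideanSpace ℝ (Fin N) → _) = fderiv ℝ u :=
      funext fun x => SchwartzMap.fderivCLM_apply ℝ u x
    rwa [h'] at h
  exact ENNReal.add_ne_top.2 ⟨h1, h2⟩

theorem enorm_norm_rpow {F : Type*} [NormedAddCommGroup F] (z : F) {p : ℝ} (hp : 0 ≤ p) :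
    ‖‖z‖ ^ p‖ₑ = ‖z‖ₑ ^ p := by
  rw [← ofReal_norm, Real.norm_of_nonneg (by positivity),
    ← ENNReal.ofReal_rpow_of_nonneg (norm_nonneg _) hp, ofReal_norm]

theorem exists_sobolevNorm_helmholtz_le {α σ a a' : ℝ} (hα : 0 < α) (hσ : 0 < σ + 1)
    (haa' : a'.HolderConjugate a) (ha : SobolevEmbedding N a)
    (hb : SobolevEmbedding N ((σ + 1) * a')) :
    ∃ C : ℝ≥0, ∀ (v : SchwartzMap (EuclideanSpace ℝ (Fin N)) ℂ)
      (u : SchwartzMap (EuclideanSpace ℝ (Fin N)) ℝ),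
      (∀ x, u x - α ^ 2 * lap N (fun y => u y) x = ‖v x‖ ^ (σ + 1)) →
        sobolevNorm u ≤ C * sobolevNorm v ^ (σ + 1) := by
  obtain ⟨A, hA⟩ := ha.exists_real haa'.symm.pos
  obtain ⟨B, hB⟩ := hb
  have ha0 : 0 < a := haa'.symm.pos
  have ha'0 : 0 < a' := haa'.pos
  set m := ENNReal.ofReal (min 1 (α ^ 2)) with hm
  have hm0 : m ≠ 0 := by
    rw [hm, Ne, ENNReal.ofReal_eq_zero, not_le]
    positivity
  have hmt : m ≠ ∞ := ENNReal.ofReal_ne_top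
  refine ⟨(m⁻¹ * 2 * B ^ (1 / a') * A ^ (1 / a)).toNNReal, fun v u h => ?_⟩
  rw [ENNReal.coe_toNNReal]
  swap
  · have := ENNReal.inv_ne_top.2 hm0
    finiteness
  have hu : ContDiff ℝ 1 u := u.smooth 1
  have hv : ContDiff ℝ 1 v := v.smooth 1
  have hbound : ∫⁻ x, ‖‖v x‖ ^ (σ + 1)‖ₑ * ‖u x‖ₑ ≤
      B ^ (1 / a') * sobolevNorm v ^ (σ + 1) * (A ^ (1 / a) * sobolevNorm u) := by
    simp_rw [enorm_norm_rpow _ hσ.le]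
    refine (ENNReal.lintegral_mul_le_Lp_mul_Lq volume haa'
      (v.continuous.enorm.measurable.pow_const _).aemeasurable
      u.continuous.enorm.measurable.aemeasurable).trans ?_
    refine mul_le_mul' ?_ ?_
    · simp_rw [← ENNReal.rpow_mul]
      refine (ENNReal.rpow_le_rpow (hB v hv) (by positivity)).trans_eq ?_
      rw [ENNReal.mul_rpow_of_nonneg _ _ (by positivity), ← ENNReal.rpow_mul]
      congr 2
      field_simp
    · refine (ENNReal.rpow_le_rpow (hA u hu) (by positivity)).trans_eq ?_
      rw [ENNReal.mul_rpow_of_nonneg _ _ (by positivity), ← ENNReal.rpow_mul,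
        mul_one_div_cancel ha0.ne', ENNReal.rpow_one]
  have hE := (lintegral_energy_le h).trans (mul_le_mul_right hbound 2)
  have hut := u.sobolevNorm_ne_top
  rcases eq_or_ne (sobolevNorm u) 0 with h0 | h0
  · rw [h0]
    exact zero_le
  rw [← ENNReal.mul_le_mul_iff_left h0 hut, ← ENNReal.mul_le_mul_iff_right hm0 hmt]
  calc m * (sobolevNorm u * sobolevNorm u) = m * sobolevNorm u ^ 2 := by ring
    _ ≤ _ := hE
    _ = (m * m⁻¹) * (2 * (B ^ (1 / a') * sobolevNorm v ^ (σ + 1) *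
          (A ^ (1 / a) * sobolevNorm u))) := by
        rw [ENNReal.mul_inv_cancel hm0 hmt, one_mul]
    _ = _ := by ring

theorem enorm_norm_rpow_mul_sq_le {σ : ℝ} (hσ : 1 ≤ σ) (z : ℂ) :
    ‖(if z = 0 then 0 else ((‖z‖ ^ (σ - 3) : ℝ) : ℂ) * z ^ 2 : ℂ)‖ₑ ≤ ‖z‖ₑ ^ (σ - 1) := by
  split_ifs with hz
  · simp
  · have hz' : 0 < ‖z‖ := norm_pos_iff.2 hz
    rw [← enorm_norm_rpow z (by linarith), ← ofReal_norm, ← ofReal_norm]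
    refine ENNReal.ofReal_le_ofReal (le_of_eq ?_)
    rw [norm_mul, Complex.norm_real, norm_pow, Real.norm_of_nonneg (by positivity),
      Real.norm_of_nonneg (by positivity), ← Real.rpow_natCast, ← Real.rpow_add hz']
    congr 1
    push_cast
    ring

/-- Hölder's inequality for the product `u |v|^{σ-1} w`. -/
theorem lintegral_rpow_triple_le {X : Type*} [MeasurableSpace X] {μ : Measure X}
    {σ c r r' : ℝ} (hσ : 1 ≤ σ) (hc : 0 < c) (hr : 0 < r) (hr' : 0 < r')
    (hexp : σ / c + 1 / r = 1 / r') {f g h : X → ℝ≥0∞} (hf : Measurable f) (hg : Measurable g)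
    (hh : Measurable h) :
    (∫⁻ x, (f x * g x ^ (σ - 1) * h x) ^ r' ∂μ) ^ (1 / r') ≤
      (∫⁻ x, f x ^ c ∂μ) ^ (1 / c) * (∫⁻ x, g x ^ c ∂μ) ^ ((σ - 1) / c) *
        (∫⁻ x, h x ^ r ∂μ) ^ (1 / r) := by
  have hσ0 : 0 ≤ σ - 1 := by linarith
  have key := ENNReal.lintegral_prod_norm_pow_le (μ := μ) Finset.univ
    (f := ![fun x => f x ^ c, fun x => g x ^ c, fun x => h x ^ r])
    (p := ![r' / c, (σ - 1) * r' / c, r' / r])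
    (by
      intro i _
      fin_cases i
      · exact (hf.pow_const _).aemeasurable
      · exact (hg.pow_const _).aemeasurable
      · exact (hh.pow_const _).aemeasurable)
    (by
      simp only [Fin.sum_univ_three, Matrix.cons_val_zero, Matrix.cons_val_one, Matrix.cons_val]
      calc r' / c + (σ - 1) * r' / c + r' / r = r' * (σ / c + 1 / r) := by ring
        _ = 1 := by rw [hexp, mul_one_div_cancel hr'.ne'])
    (by
      intro i _
      fin_cases i
      · exact (div_pos hr' hc).le
      · exact div_nonneg (mul_nonneg hσ0 hr'.le) hc.le
      · exact (div_pos hr' hr).le)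
  simp only [Fin.prod_univ_three, Matrix.cons_val_zero, Matrix.cons_val_one, Matrix.cons_val,
    ← ENNReal.rpow_mul] at key
  have e1 : c * (r' / c) = r' := by field_simp
  have e2 : c * ((σ - 1) * r' / c) = (σ - 1) * r' := by field_simp
  have e3 : r * (r' / r) = r' := by field_simp
  rw [e1, e2, e3] at key
  have hl : ∀ x, (f x * g x ^ (σ - 1) * h x) ^ r' = f x ^ r' * g x ^ ((σ - 1) * r') * h x ^ r' :=
    fun x => by
      rw [ENNReal.mul_rpow_of_nonneg _ _ hr'.le, ENNReal.mul_rpow_of_nonneg _ _ hr'.le,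
        ← ENNReal.rpow_mul]
  simp_rw [hl]
  refine (ENNReal.rpow_le_rpow key (by positivity)).trans_eq ?_
  have hn : 0 ≤ 1 / r' := by positivity
  rw [ENNReal.mul_rpow_of_nonneg _ _ hn, ENNReal.mul_rpow_of_nonneg _ _ hn,
    ← ENNReal.rpow_mul, ← ENNReal.rpow_mul, ← ENNReal.rpow_mul]
  have f1 : r' / c * (1 / r') = 1 / c := by field_simp
  have f2 : (σ - 1) * r' / c * (1 / r') = (σ - 1) / c := by field_simp
  have f3 : r' / r * (1 / r') = 1 / r := by field_simp
  rw [f1, f2, f3]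

theorem toReal_sobolevNorm_le (v : SchwartzMap (EuclideanSpace ℝ (Fin N)) ℂ) :
    (sobolevNorm v).toReal ≤ 2 * H1norm N (fun y => v y) := by
  have h := ENNReal.add_ne_top.1 v.sobolevNorm_ne_top
  have h1 : LpN N (fun y => v y) 2 ≤ H1norm N (fun y => v y) :=
    Real.le_sqrt_of_sq_le (by linarith [sq_nonneg (gradL2 N fun y => v y)])
  have h2 : gradL2 N (fun y => v y) ≤ H1norm N (fun y => v y) :=
    Real.le_sqrt_of_sq_le (by linarith [sq_nonneg (LpN N (fun y => v y) 2)])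
  have h3 : (sobolevNorm v).toReal = LpN N (fun y => v y) 2 + gradL2 N (fun y => v y) := by
    rw [sobolevNorm, ENNReal.toReal_add h.1 h.2, LpN, gradL2, ENNReal.ofReal_ofNat]
  linarith

theorem rpow_mul_rpow_eq {σ c : ℝ} (hσ : 1 ≤ σ) (hc0 : 0 < c) (A K B : ℝ≥0) (S : ℝ≥0∞) :
    (A * (K * S ^ (σ + 1)) ^ c) ^ (1 / c) * (B * S ^ c) ^ ((σ - 1) / c) =
      (A ^ (1 / c) * K * B ^ ((σ - 1) / c) : ℝ≥0) * S ^ (2 * σ) := by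
  have hσ0 : 0 ≤ σ - 1 := by linarith
  have h1 : 0 ≤ 1 / c := by positivity
  have h2 : 0 ≤ (σ - 1) / c := by positivity
  rw [ENNReal.mul_rpow_of_nonneg _ _ h1, ENNReal.mul_rpow_of_nonneg _ _ h2,
    ← ENNReal.rpow_mul, ← ENNReal.rpow_mul, mul_one_div_cancel hc0.ne',
    ENNReal.rpow_one, mul_div_cancel₀ _ hc0.ne', ENNReal.coe_mul, ENNReal.coe_mul,
    ENNReal.coe_rpow_of_nonneg _ h1, ENNReal.coe_rpow_of_nonneg _ h2,
    show 2 * σ = (σ + 1) + (σ - 1) by ring,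
    ENNReal.rpow_add_of_nonneg (σ + 1) (σ - 1) (by linarith) hσ0]
  ring

theorem eLpNorm_mul_rpow_mul_sq_le {σ c r r' : ℝ} (hσ : 1 ≤ σ) (hc : 0 < c) (hr : 0 < r)
    (hr' : 0 < r') (hexp : σ / c + 1 / r = 1 / r')
    {u : EuclideanSpace ℝ (Fin N) → ℝ} {v w : EuclideanSpace ℝ (Fin N) → ℂ}
    (hu : Continuous u) (hv : Continuous v) (hw : Continuous w) :
    eLpNorm (fun x => (u x : ℂ) *
      (if v x = 0 then 0 else ((‖v x‖ ^ (σ - 3) : ℝ) : ℂ) * (v x) ^ 2) * w x)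
      (ENNReal.ofReal r') volume ≤
        (∫⁻ x, ‖u x‖ₑ ^ c) ^ (1 / c) * (∫⁻ x, ‖v x‖ₑ ^ c) ^ ((σ - 1) / c) *
          eLpNorm w (ENNReal.ofReal r) volume := by
  rw [eLpNorm_eq_lintegral_rpow_enorm_toReal (by simpa using hr') ENNReal.ofReal_ne_top,
    eLpNorm_eq_lintegral_rpow_enorm_toReal (by simpa using hr) ENNReal.ofReal_ne_top,
    ENNReal.toReal_ofReal hr.le, ENNReal.toReal_ofReal hr'.le]
  refine le_trans ?_ (lintegral_rpow_triple_le hσ hc hr hr' hexp hu.enorm.measurable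
    hv.enorm.measurable hw.enorm.measurable)
  refine ENNReal.rpow_le_rpow (lintegral_mono fun x => ENNReal.rpow_le_rpow ?_ hr'.le)
    (by positivity)
  rw [enorm_mul, enorm_mul]
  refine mul_le_mul' (mul_le_mul' ?_ (enorm_norm_rpow_mul_sq_le hσ _)) le_rfl
  rw [← ofReal_norm, ← ofReal_norm, Complex.norm_real]

theorem exists_LpN_helmholtz_mul_le {α σ a a' c r r' : ℝ} (hα : 0 < α) (hσ : 1 ≤ σ)
    (haa' : a'.HolderConjugate a) (ha : SobolevEmbedding N a)
    (hb : SobolevEmbedding N ((σ + 1) * a')) (hc0 : 0 < c) (hc : SobolevEmbedding N c)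
    (hr : 0 < r) (hr' : 0 < r') (hexp : σ / c + 1 / r = 1 / r') :
    ∃ C : ℝ, 0 < C ∧ ∀ (v : SchwartzMap (EuclideanSpace ℝ (Fin N)) ℂ)
      (u : SchwartzMap (EuclideanSpace ℝ (Fin N)) ℝ),
      (∀ x, u x - α ^ 2 * lap N (fun y => u y) x = ‖v x‖ ^ (σ + 1)) →
      ∀ w : SchwartzMap (EuclideanSpace ℝ (Fin N)) ℂ,
        LpN N (fun x => (u x : ℂ) *
            (if v x = 0 then 0 else ((‖v x‖ ^ (σ - 3) : ℝ) : ℂ) * (v x) ^ 2) * w x) r' ≤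
          C * (H1norm N (fun y => v y)) ^ (2 * σ) * LpN N (fun x => w x) r := by
  have hσ0 : 0 ≤ σ - 1 := by linarith
  obtain ⟨K, hK⟩ := exists_sobolevNorm_helmholtz_le hα (by linarith) haa' ha hb
  obtain ⟨A, hA⟩ := hc.exists_real hc0
  obtain ⟨B, hB⟩ := hc
  set D : ℝ≥0 := A ^ (1 / c) * K * B ^ ((σ - 1) / c) + 1 with hD
  refine ⟨D * 2 ^ (2 * σ), by positivity, fun v u h w => ?_⟩
  have hvt := v.sobolevNorm_ne_top
  have hwt : eLpNorm w (ENNReal.ofReal r) volume ≠ ∞ :=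
    (w.memLp (ENNReal.ofReal r) volume).eLpNorm_ne_top
  have hmain := eLpNorm_mul_rpow_mul_sq_le hσ hc0 hr hr' hexp u.continuous v.continuous
    w.continuous
  have hu : ∫⁻ x, ‖u x‖ₑ ^ c ≤ A * (K * sobolevNorm v ^ (σ + 1)) ^ c :=
    (hA u (u.smooth 1)).trans (mul_le_mul_right (ENNReal.rpow_le_rpow (hK v u h) hc0.le) _)
  have hcoef : (∫⁻ x, ‖u x‖ₑ ^ c) ^ (1 / c) * (∫⁻ x, ‖v x‖ₑ ^ c) ^ ((σ - 1) / c) ≤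
      D * sobolevNorm v ^ (2 * σ) := by
    refine (mul_le_mul' (ENNReal.rpow_le_rpow hu (by positivity))
      (ENNReal.rpow_le_rpow (hB v (v.smooth 1)) (by positivity))).trans ?_
    rw [rpow_mul_rpow_eq hσ hc0]
    refine mul_le_mul_left (ENNReal.coe_le_coe.2 ?_) _
    rw [hD]
    exact le_self_add
  have hpow : sobolevNorm v ^ (2 * σ) ≠ ∞ := ENNReal.rpow_ne_top_of_nonneg (by linarith) hvt
  have hreal := ENNReal.toReal_mono
    (ENNReal.mul_ne_top (ENNReal.mul_ne_top ENNReal.coe_ne_top hpow) hwt)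
    (hmain.trans (mul_le_mul_left hcoef _))
  rw [ENNReal.toReal_mul, ENNReal.toReal_mul, ← ENNReal.toReal_rpow, ENNReal.coe_toReal] at hreal
  refine hreal.trans (mul_le_mul_of_nonneg_right ?_ ENNReal.toReal_nonneg)
  have hH : 0 ≤ H1norm N (fun y => v y) := Real.sqrt_nonneg _
  rw [mul_assoc (D : ℝ), ← Real.mul_rpow zero_le_two hH]
  exact mul_le_mul_of_nonneg_left (Real.rpow_le_rpow ENNReal.toReal_nonneg
    (toReal_sobolevNorm_le v) (by linarith)) D.coe_nonneg

end Estimate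

/-- (Lemma 4, second estimate) estimate for
`‖B(|v|^{σ+1})|v|^{σ-3}v²(v₁-v₂)‖_{r'} ≤ C_α ‖v‖_{H¹}^{2σ} ‖v₁-v₂‖_r`,
where `u = B(|v|^{σ+1})` solves the Helmholtz equation `u - α²Δu = |v|^{σ+1}`,
and `|v|^{σ-3}v²` is interpreted as `0` at points where `v` vanishes. -/
theorem stmt5 (N : ℕ) (hN : 1 ≤ N) (α : ℝ) (hα : 0 < α) (σ : ℝ) (hσ : 1 ≤ σ)
    (hσ' : 2 < N → σ < 4 / ((N : ℝ) - 2)) :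
    ∃ r r' : ℝ, 2 < r ∧ (2 < N → r ≤ 2 * N / ((N : ℝ) - 2)) ∧ (N ≤ 2 → r ≤ 4) ∧
      1 / r + 1 / r' = 1 ∧
      ∃ C : ℝ, 0 < C ∧
        ∀ (v : SchwartzMap (EuclideanSpace ℝ (Fin N)) ℂ)
          (u : SchwartzMap (EuclideanSpace ℝ (Fin N)) ℝ),
          (∀ x, u x - α ^ 2 * lap N (fun y => u y) x = ‖v x‖ ^ (σ + 1)) →
          ∀ (v₁ v₂ : SchwartzMap (EuclideanSpace ℝ (Fin N)) ℂ),
            LpN N (fun x =>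
                (u x : ℂ) *
                  (if v x = 0 then 0 else ((‖v x‖ ^ (σ - 3) : ℝ) : ℂ) * (v x) ^ 2) *
                  (v₁ x - v₂ x)) r'
              ≤ C * (H1norm N (fun y => v y)) ^ (2 * σ) *
                  LpN N (fun x => v₁ x - v₂ x) r := by
  suffices h : ∃ a a' c r r' : ℝ, a'.HolderConjugate a ∧ SobolevEmbedding N a ∧
      SobolevEmbedding N ((σ + 1) * a') ∧ 0 < c ∧ SobolevEmbedding N c ∧ 0 < r' ∧
      σ / c + 1 / r = 1 / r' ∧ 2 < r ∧ (2 < N → r ≤ 2 * N / ((N : ℝ) - 2)) ∧ (N ≤ 2 → r ≤ 4) ∧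
      1 / r + 1 / r' = 1 by
    obtain ⟨a, a', c, r, r', haa', ha, hb, hc0, hc, hr', hexp, h2r, hN3, hN2, hrr'⟩ := h
    obtain ⟨C, hC0, hC⟩ := exists_LpN_helmholtz_mul_le hα hσ haa' ha hb hc0 hc
      (by linarith) hr' hexp
    exact ⟨r, r', h2r, hN3, hN2, hrr', C, hC0, fun v u h v₁ v₂ => hC v u h (v₁ - v₂)⟩
  rcases le_or_gt N 2 with hN2 | hN2
  · refine ⟨2, 2, 2 * σ, 4, 4 / 3, Real.HolderConjugate.two_two, SobolevEmbedding.two N,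
      sobolevEmbedding_of_le_two hN hN2 (by linarith), by linarith,
      sobolevEmbedding_of_le_two hN hN2 (by linarith), by norm_num, ?_, by norm_num,
      fun h => absurd h (by omega), fun _ => le_rfl, by norm_num⟩
    have : σ ≠ 0 := by linarith
    field_simp
    norm_num
  · have hn : (2 : ℝ) < N := by exact_mod_cast hN2
    have hs := hσ' hN2
    generalize hm : (N : ℝ) = n at *
    have hn2 : 0 < n - 2 := by linarith
    have hn0 : 0 < n := by linarith
    rw [lt_div_iff₀ hn2] at hs
    have hd : 0 < 2 * n - σ * (n - 2) := by linarith
    have hd' : 0 < 2 * n + σ * (n - 2) := by positivity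
    have hcrit : SobolevEmbedding N (2 * n / (n - 2)) := hm ▸ sobolevEmbedding_critical hN2
    refine ⟨2 * n / (n - 2), 2 * n / (n + 2), 2 * n / (n - 2),
      4 * n / (2 * n - σ * (n - 2)), 4 * n / (2 * n + σ * (n - 2)), ?_, hcrit,
      hcrit.mono ?_ ?_, by positivity, hcrit, by positivity, ?_, ?_, fun _ => ?_,
      fun h => absurd h (by omega), ?_⟩
    · rw [Real.holderConjugate_iff, lt_div_iff₀ (by linarith)]
      refine ⟨by linarith, ?_⟩
      field_simp
      ring
    · rw [← mul_div_assoc, le_div_iff₀ (by linarith)]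
      nlinarith
    · rw [← mul_div_assoc, div_le_div_iff₀ (by linarith) hn2]
      nlinarith
    · field_simp
      ring
    · rw [lt_div_iff₀ hd]
      nlinarith
    · rw [div_le_div_iff₀ hd hn2]
      nlinarith
    · field_simp
      ring
end
end

section
/- Let N ≥ 3, α > 0 and σ ≥ 1. There exists a constant C_α > 0, depending only on N, σ, α, such that for every Schwartz function v : ℝ^N → ℂ and every Schwartz function u : ℝ^N → ℝ satisfying u − α²Δu = |v|^{σ+1} pointwise on ℝ^N, one has ‖u‖_{L^{2N/(N−2)}} ≤ C_α ‖v‖_{L^{(σ+1)·2N/(N+2)}}^{σ+1}. -/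
open MeasureTheory Real Set
open scoped ENNReal NNReal ComplexConjugate

noncomputable section

open Filter Topology LineDeriv Module

section Cutoff

variable {E : Type*} [NormedAddCommGroup E] [InnerProductSpace ℝ E] [FiniteDimensional ℝ E]

/-- Smooth cutoffs equal to `1` on the ball of radius `n + 1`, with gradient of size
`O(1 / (n + 1))`. -/
theorem exists_smooth_cutoff_fderiv_le :
    ∃ K : ℝ≥0, ∀ n : ℕ, ∃ χ : E → ℝ, ContDiff ℝ 1 χ ∧ HasCompactSupport χ ∧
      (∀ x, |χ x| ≤ 1) ∧ (∀ x, ‖x‖ ≤ n + 1 → χ x = 1) ∧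
      ∀ x, ‖fderiv ℝ χ x‖ ≤ (n + 1 : ℝ)⁻¹ * K := by
  let f : ContDiffBump (0 : E) := ⟨1, 2, one_pos, one_lt_two⟩
  have hf : ContDiff ℝ 1 f := f.contDiff
  obtain ⟨K, hK⟩ := (hf.continuous_fderiv one_ne_zero).bounded_above_of_compact_support
    (f.hasCompactSupport.fderiv ℝ)
  have hK0 : 0 ≤ K := (norm_nonneg _).trans (hK 0)
  refine ⟨⟨K, hK0⟩, fun n => ⟨fun x => f ((n + 1 : ℝ)⁻¹ • x), ?_, ?_, ?_, ?_, ?_⟩⟩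
  · exact hf.comp (contDiff_const_smul _)
  · exact f.hasCompactSupport.comp_homeomorph (Homeomorph.smulOfNeZero _ (by positivity))
  · intro x
    rw [abs_of_nonneg f.nonneg]
    exact f.le_one
  · intro x hx
    apply f.one_of_mem_closedBall
    rw [mem_closedBall_zero_iff, norm_smul, norm_inv, Real.norm_of_nonneg (by positivity)]
    exact inv_mul_le_one_of_le₀ hx (by positivity)
  · intro x
    rw [fderiv_comp_smul, norm_smul, norm_inv, Real.norm_of_nonneg (by positivity)]
    exact mul_le_mul_of_nonneg_left (hK _) (by positivity)

/-- The Gagliardo–Nirenberg–Sobolev inequality without the assumption of compact support. -/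
theorem eLpNorm_le_eLpNorm_fderiv_of_eq_of_memLp [MeasurableSpace E] [BorelSpace E]
    (μ : Measure E) [μ.IsAddHaarMeasure] {p p' : ℝ≥0} (hp : 1 ≤ p) (hn : 0 < finrank ℝ E)
    (hp' : (p' : ℝ)⁻¹ = p⁻¹ - (finrank ℝ E : ℝ)⁻¹) {u : E → ℝ} (hu : ContDiff ℝ 1 u)
    (hup : MemLp u p μ) :
    eLpNorm u p' μ ≤ eLpNormLESNormFDerivOfEqInnerConst μ p * eLpNorm (fderiv ℝ u) p μ := by
  obtain ⟨K, hK⟩ := exists_smooth_cutoff_fderiv_le (E := E)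
  choose χ hχ hχs hχ1 hχe hχd using hK
  set S : ℝ≥0∞ := (eLpNormLESNormFDerivOfEqInnerConst μ p : ℝ≥0∞)
  have hp1 : (1 : ℝ≥0∞) ≤ p := by exact_mod_cast hp
  have hmeas : AEStronglyMeasurable (fderiv ℝ u) μ :=
    (hu.continuous_fderiv one_ne_zero).aestronglyMeasurable
  have hbound (n : ℕ) : eLpNorm (fun x => χ n x * u x) p' μ ≤
      S * (eLpNorm (fderiv ℝ u) p μ +
        ENNReal.ofReal ((n + 1 : ℝ)⁻¹ * K) * eLpNorm u p μ) := by
    refine (eLpNorm_le_eLpNorm_fderiv_of_eq_inner μ ((hχ n).mul hu) (hχs n).mul_right hp hn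
      hp').trans ?_
    gcongr
    have h1 : eLpNorm (fderiv ℝ (fun x => χ n x * u x)) p μ ≤
        eLpNorm (fun x => ‖fderiv ℝ u x‖ + ((n + 1 : ℝ)⁻¹ * K) * ‖u x‖) p μ := by
      refine eLpNorm_mono_real fun x => ?_
      rw [fderiv_fun_mul ((hχ n).differentiable one_ne_zero x) (hu.differentiable one_ne_zero x)]
      refine (norm_add_le _ _).trans ?_
      rw [norm_smul, norm_smul, mul_comm ‖u x‖]
      exact add_le_add (mul_le_of_le_one_left (norm_nonneg _) (hχ1 n x))
        (mul_le_mul_of_nonneg_right (hχd n x) (norm_nonneg _))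
    refine h1.trans ((eLpNorm_add_le hmeas.norm (hup.1.norm.const_mul _) hp1).trans ?_)
    rw [eLpNorm_norm]
    gcongr
    refine (eLpNorm_const_smul_le (c := (n + 1 : ℝ)⁻¹ * K) (f := fun x => ‖u x‖)).trans ?_
    rw [eLpNorm_norm, Real.enorm_of_nonneg (by positivity)]
  have hlim : Tendsto (fun n : ℕ => S * (eLpNorm (fderiv ℝ u) p μ +
      ENNReal.ofReal ((n + 1 : ℝ)⁻¹ * K) * eLpNorm u p μ)) atTop
      (𝓝 (S * (eLpNorm (fderiv ℝ u) p μ + ENNReal.ofReal (0 * K) * eLpNorm u p μ))) := by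
    refine ENNReal.Tendsto.const_mul (tendsto_const_nhds.add ?_) (Or.inr ENNReal.coe_ne_top)
    refine ENNReal.Tendsto.mul_const ?_ (Or.inr hup.2.ne)
    refine ENNReal.tendsto_ofReal (Tendsto.mul_const _ ?_)
    exact tendsto_inv_atTop_zero.comp
      (tendsto_atTop_add_const_right _ _ tendsto_natCast_atTop_atTop)
  have hfatou : eLpNorm u p' μ ≤
      atTop.liminf fun n => eLpNorm (fun x => χ n x * u x) p' μ := by
    refine Lp.eLpNorm_lim_le_liminf_eLpNorm
      (fun n => ((hχ n).continuous.mul hu.continuous).aestronglyMeasurable) u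
      (ae_of_all _ fun x => ?_)
    refine tendsto_const_nhds.congr' ?_
    obtain ⟨m, hm⟩ := exists_nat_ge ‖x‖
    filter_upwards [eventually_ge_atTop m] with n hn
    have : (m : ℝ) ≤ n := by exact_mod_cast hn
    rw [Pi.mul_apply, hχe n x (by linarith), one_mul]
  calc eLpNorm u p' μ ≤ _ := hfatou
    _ ≤ _ := liminf_le_liminf (Eventually.of_forall hbound)
    _ = _ := hlim.liminf_eq
    _ = _ := by simp

end Cutoff

/-- Hölder's inequality for a product of real functions. -/
theorem integral_mul_le_toReal_eLpNorm_mul {X : Type*} [MeasurableSpace X] {μ : Measure X}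
    {p q : ℝ} (hpq : p.HolderConjugate q) {f g : X → ℝ}
    (hf : MemLp f (ENNReal.ofReal p) μ) (hg : MemLp g (ENNReal.ofReal q) μ) :
    ∫ x, f x * g x ∂μ ≤
      (eLpNorm f (ENNReal.ofReal p) μ).toReal * (eLpNorm g (ENNReal.ofReal q) μ).toReal := by
  have key {r : ℝ} (hr : 0 < r) {h : X → ℝ} (hh : MemLp h (ENNReal.ofReal r) μ) :
      (eLpNorm h (ENNReal.ofReal r) μ).toReal = (∫ x, ‖h x‖ ^ r ∂μ) ^ (1 / r) := by
    rw [hh.eLpNorm_eq_integral_rpow_norm (by simpa using hr) ENNReal.ofReal_ne_top,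
      ENNReal.toReal_ofReal hr.le, ENNReal.toReal_ofReal (by positivity), one_div]
  rw [key hpq.pos hf, key hpq.symm.pos hg]
  refine le_trans ?_ (integral_mul_norm_le_Lp_mul_Lq hpq hf hg)
  simp_rw [← norm_mul]
  exact (le_abs_self _).trans (norm_integral_le_integral_norm (fun x => f x * g x))

theorem norm_sq_eq_sum_sq_basisVec {N : ℕ} (L : EuclideanSpace ℝ (Fin N) →L[ℝ] ℝ) :
    ‖L‖ ^ 2 = ∑ i, L (basisVec N i) ^ 2 := by
  have h := (EuclideanSpace.basisFun (Fin N) ℝ).sum_sq_norm_inner_left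
    ((InnerProductSpace.toDual ℝ _).symm L)
  rw [LinearIsometryEquiv.norm_map] at h
  rw [← h]
  refine Finset.sum_congr rfl fun i _ => ?_
  rw [InnerProductSpace.toDual_symm_apply, Real.norm_eq_abs, sq_abs]
  simp [basisVec]

section Schwartz

variable {N : ℕ}

theorem lap_schwartz_eq (u : SchwartzMap (EuclideanSpace ℝ (Fin N)) ℝ)
    (x : EuclideanSpace ℝ (Fin N)) :
    lap N (fun y => u y) x = ∑ i, ∂_{basisVec N i} (∂_{basisVec N i} u) x := rfl

theorem integrable_schwartz_mul (f g : SchwartzMap (EuclideanSpace ℝ (Fin N)) ℝ) :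
    Integrable (fun x => f x * g x) :=
  (SchwartzMap.pairing (ContinuousLinearMap.mul ℝ ℝ) f g).integrable

theorem memLp_two_fderiv_schwartz (u : SchwartzMap (EuclideanSpace ℝ (Fin N)) ℝ) :
    MemLp (fderiv ℝ u) 2 volume := by
  have h := (SchwartzMap.fderivCLM ℝ _ ℝ u).memLp 2 (volume : Measure (EuclideanSpace ℝ (Fin N)))
  exact h

theorem toReal_eLpNorm_fderiv_sq (u : SchwartzMap (EuclideanSpace ℝ (Fin N)) ℝ) :
    (eLpNorm (fderiv ℝ u) 2 volume).toReal ^ 2 = ∫ x, ‖fderiv ℝ u x‖ ^ 2 := by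
  have hm := memLp_two_fderiv_schwartz u
  rw [hm.eLpNorm_eq_integral_rpow_norm two_ne_zero ENNReal.ofNat_ne_top,
    ENNReal.toReal_ofReal (by positivity), ENNReal.toReal_ofNat, ← Real.rpow_natCast,
    ← Real.rpow_mul (by positivity)]
  norm_num

/-- The Dirichlet energy of a Schwartz function, after an integration by parts. -/
theorem integral_mul_lap_eq_neg (u : SchwartzMap (EuclideanSpace ℝ (Fin N)) ℝ) :
    ∫ x, u x * lap N (fun y => u y) x = -∫ x, ‖fderiv ℝ u x‖ ^ 2 := by
  simp_rw [norm_sq_eq_sum_sq_basisVec, lap_schwartz_eq, Finset.mul_sum]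
  rw [integral_finsetSum _ fun i _ => integrable_schwartz_mul _ _, integral_finsetSum,
    ← Finset.sum_neg_distrib]
  · refine Finset.sum_congr rfl fun i _ => ?_
    rw [SchwartzMap.integral_mul_lineDerivOp_right_eq_neg_left]
    simp_rw [sq]
    rfl
  · intro i _
    simpa only [sq] using! integrable_schwartz_mul (∂_{basisVec N i} u) (∂_{basisVec N i} u)

/-- The energy estimate for `u - α²Δu = f`. -/
theorem sq_mul_toReal_eLpNorm_fderiv_sq_le (α : ℝ)
    (u : SchwartzMap (EuclideanSpace ℝ (Fin N)) ℝ) :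
    α ^ 2 * (eLpNorm (fderiv ℝ u) 2 volume).toReal ^ 2 ≤
      ∫ x, u x * (u x - α ^ 2 * lap N (fun y => u y) x) := by
  have hi : Integrable fun x => u x * lap N (fun y => u y) x := by
    simp_rw [lap_schwartz_eq, Finset.mul_sum]
    exact integrable_finsetSum _ fun i _ => integrable_schwartz_mul _ _
  have he : ∀ x, u x * (u x - α ^ 2 * lap N (fun y => u y) x) =
      u x * u x - α ^ 2 * (u x * lap N (fun y => u y) x) := fun x => by ring
  simp_rw [he]
  rw [integral_sub (integrable_schwartz_mul u u) (hi.const_mul _), integral_const_mul,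
    integral_mul_lap_eq_neg, toReal_eLpNorm_fderiv_sq]
  have : 0 ≤ ∫ x, u x * u x := integral_nonneg fun x => mul_self_nonneg _
  linarith

theorem toReal_eLpNorm_norm_rpow_eq_LpN (v : EuclideanSpace ℝ (Fin N) → ℂ) {q s : ℝ}
    (hq : 0 ≤ q) (hs : 0 < s) :
    (eLpNorm (fun x => ‖v x‖ ^ s) (ENNReal.ofReal q) volume).toReal = LpN N v (s * q) ^ s := by
  rw [eLpNorm_norm_rpow _ hs, ← ENNReal.toReal_rpow, ← ENNReal.ofReal_mul hq, mul_comm q, LpN]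

theorem memLp_norm_rpow_schwartz (v : SchwartzMap (EuclideanSpace ℝ (Fin N)) ℂ) {q s : ℝ}
    (hq : 0 ≤ q) (hs : 0 < s) :
    MemLp (fun x => ‖v x‖ ^ s) (ENNReal.ofReal q) volume := by
  refine ⟨(v.continuous.norm.rpow_const fun _ => Or.inr hs.le).aestronglyMeasurable, ?_⟩
  rw [eLpNorm_norm_rpow _ hs, ← ENNReal.ofReal_mul hq]
  have h := (v.memLp (ENNReal.ofReal (q * s)) volume).eLpNorm_ne_top
  exact ENNReal.rpow_lt_top_of_nonneg hs.le h

end Schwartz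

/-- elliptic estimate `‖u‖_{L^{2N/(N-2)}} ≤ C_α ‖v‖_{L^{(σ+1)·2N/(N+2)}}^{σ+1}`
for the solution of the Helmholtz equation `u - α²Δu = |v|^{σ+1}`, `N ≥ 3`. -/
theorem stmt6 (N : ℕ) (hN : 3 ≤ N) (α : ℝ) (hα : 0 < α) (σ : ℝ) (hσ : 1 ≤ σ) :
    ∃ C : ℝ, 0 < C ∧
      ∀ (v : SchwartzMap (EuclideanSpace ℝ (Fin N)) ℂ)
        (u : SchwartzMap (EuclideanSpace ℝ (Fin N)) ℝ),
        (∀ x, u x - α ^ 2 * lap N (fun y => u y) x = ‖v x‖ ^ (σ + 1)) →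
        LpN N (fun x => u x) (2 * N / ((N : ℝ) - 2))
          ≤ C * (LpN N (fun x => v x) ((σ + 1) * (2 * N / ((N : ℝ) + 2)))) ^ (σ + 1) := by
  have hN' : (3 : ℝ) ≤ N := by exact_mod_cast hN
  have hN2 : 0 < (N : ℝ) - 2 := by linarith
  set p : ℝ := 2 * N / ((N : ℝ) - 2) with hp
  set q : ℝ := 2 * N / ((N : ℝ) + 2) with hq
  have hp0 : 0 < p := by positivity
  have hq0 : 0 < q := by positivity
  have hσ0 : 0 < σ + 1 := by linarith
  have hpq : p.HolderConjugate q := by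
    rw [Real.holderConjugate_iff, hp, hq]
    refine ⟨?_, ?_⟩
    · rw [lt_div_iff₀ hN2]
      linarith
    · field_simp
      ring
  let S : ℝ≥0 := eLpNormLESNormFDerivOfEqInnerConst
    (volume : Measure (EuclideanSpace ℝ (Fin N))) 2
  refine ⟨(S : ℝ) ^ 2 / α ^ 2 + 1, by positivity, fun v u huv => ?_⟩
  have hSob : LpN N (fun x => u x) p ≤ S * (eLpNorm (fderiv ℝ u) 2 volume).toReal := by
    have h := eLpNorm_le_eLpNorm_fderiv_of_eq_of_memLp
      (volume : Measure (EuclideanSpace ℝ (Fin N))) (p := 2) (p' := p.toNNReal)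
      one_le_two (by rw [finrank_euclideanSpace_fin]; omega)
      (by
        rw [finrank_euclideanSpace_fin, Real.coe_toNNReal _ hp0.le, hp]
        push_cast
        field_simp)
      (u.smooth 1) (u.memLp _)
    have hfin : eLpNorm (fderiv ℝ u) 2 volume ≠ ∞ :=
      (memLp_two_fderiv_schwartz u).2.ne
    have h' := ENNReal.toReal_mono (ENNReal.mul_ne_top ENNReal.coe_ne_top hfin) h
    rwa [ENNReal.toReal_mul, ENNReal.coe_toReal] at h'
  have hnorm := toReal_eLpNorm_norm_rpow_eq_LpN (fun x => v x) hq0.le hσ0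
  have hf := memLp_norm_rpow_schwartz v hq0.le hσ0
  have henergy := sq_mul_toReal_eLpNorm_fderiv_sq_le α u
  simp_rw [huv] at henergy
  have hholder := integral_mul_le_toReal_eLpNorm_mul hpq (u.memLp (ENNReal.ofReal p)) hf
  rw [hnorm] at hholder
  change _ ≤ LpN N (fun x => u x) p * _ at hholder
  set A := LpN N (fun x => u x) p
  set B := LpN N (fun x => v x) ((σ + 1) * q) ^ (σ + 1)
  set G := (eLpNorm (fderiv ℝ u) 2 volume).toReal
  have hA : 0 ≤ A := ENNReal.toReal_nonneg
  have hB : 0 ≤ B := Real.rpow_nonneg ENNReal.toReal_nonneg _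
  have hAA : A * A ≤ A * ((S : ℝ) ^ 2 / α ^ 2 * B) := by
    calc A * A ≤ (S * G) * (S * G) := mul_self_le_mul_self hA hSob
      _ = (S : ℝ) ^ 2 / α ^ 2 * (α ^ 2 * G ^ 2) := by field_simp
      _ ≤ (S : ℝ) ^ 2 / α ^ 2 * (A * B) := by
          exact mul_le_mul_of_nonneg_left (henergy.trans hholder) (by positivity)
      _ = _ := by ring
  rcases hA.eq_or_lt with h0 | h0
  · rw [← h0]
    positivity
  · have := le_of_mul_le_mul_left hAA h0
    linarith
end
end

section
/- Let N ≥ 3, α > 0 and σ ≥ 1. There exists a constant C_α > 0, depending only on N, σ, α, such that for every Schwartz function v : ℝ^N → ℂ and every Schwartz function u : ℝ^N → ℝ satisfying u − α²Δu = |v|^{σ+1} pointwise on ℝ^N, one has |∫_{ℝ^N} u(x) |v(x)|^{σ+1} dx| ≤ C_α ‖v‖_{L^{2N(σ+1)/(N+2)}}^{2(σ+1)}. -/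
open MeasureTheory Real Set
open scoped ENNReal NNReal ComplexConjugate

noncomputable section

open Filter Topology
open scoped LineDeriv

theorem eLpNorm_le_eLpNorm_fderiv_of_memLp {E F : Type*} [NormedAddCommGroup E] [NormedSpace ℝ E]
    [MeasurableSpace E] [BorelSpace E] [FiniteDimensional ℝ E] (μ : Measure E)
    [μ.IsAddHaarMeasure] [NormedAddCommGroup F] [InnerProductSpace ℝ F] {u : E → F}
    (hu : ContDiff ℝ 1 u) {p p' : ℝ≥0} (hp : 1 ≤ p) (hup : MemLp u p μ)
    (hn : 0 < Module.finrank ℝ E)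
    (hp' : (p' : ℝ)⁻¹ = p⁻¹ - (Module.finrank ℝ E : ℝ)⁻¹) :
    eLpNorm u p' μ ≤ eLpNormLESNormFDerivOfEqInnerConst μ p * eLpNorm (fderiv ℝ u) p μ := by
  let φ : ContDiffBump (0 : E) := ⟨1, 2, by norm_num, by norm_num⟩
  have hφ : ContDiff ℝ 1 φ := φ.contDiff
  obtain ⟨M, hM⟩ := (hφ.continuous_fderiv one_ne_zero).bounded_above_of_compact_support
    (φ.hasCompactSupport.fderiv ℝ)
  let r : ℕ → ℝ := fun n ↦ ((n : ℝ) + 1)⁻¹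
  have hr : ∀ n, 0 < r n := fun n ↦ by positivity
  have hr0 : Tendsto r atTop (𝓝 0) := by
    simpa [r, one_div] using tendsto_one_div_add_atTop_nhds_zero_nat (𝕜 := ℝ)
  let w : ℕ → E → F := fun n x ↦ φ (r n • x) • u x
  have hw : ∀ n, ContDiff ℝ 1 (w n) := fun n ↦ by fun_prop
  have hwc : ∀ n, HasCompactSupport (w n) := fun n ↦
    (φ.hasCompactSupport.comp_smul (hr n).ne').smul_right
  have hlim : ∀ x, Tendsto (fun n ↦ w n x) atTop (𝓝 (u x)) := fun x ↦ by
    have h1 : Tendsto (fun n ↦ φ (r n • x)) atTop (𝓝 (φ 0)) := by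
      refine (φ.continuous.tendsto 0).comp ?_
      simpa using hr0.smul_const x
    rw [φ.one_of_mem_closedBall (by simp [φ])] at h1
    simpa using h1.smul_const (u x)
  have hbound : ∀ n, eLpNorm (fderiv ℝ (w n)) p μ ≤
      eLpNorm (fderiv ℝ u) p μ + ENNReal.ofReal (r n * M) * eLpNorm u p μ := fun n ↦ by
    have hd : ∀ x, ‖fderiv ℝ (w n) x‖ ≤ ‖‖fderiv ℝ u x‖ + (r n * M) * ‖u x‖‖ := fun x ↦ by
      have h1 : HasFDerivAt (fun y : E ↦ φ (r n • y))
          ((fderiv ℝ φ (r n • x)).comp (r n • ContinuousLinearMap.id ℝ E)) x :=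
        ((hφ.differentiable one_ne_zero _).hasFDerivAt).comp x ((hasFDerivAt_id x).const_smul (r n))
      have h2 := h1.smul (hu.differentiable one_ne_zero x).hasFDerivAt
      have hM0 : 0 ≤ M := (norm_nonneg _).trans (hM 0)
      rw [show fderiv ℝ (w n) x = _ from h2.fderiv, Real.norm_of_nonneg (by have := (hr n).le; positivity)]
      refine (norm_add_le _ _).trans (add_le_add ?_ ?_)
      · rw [norm_smul, Real.norm_of_nonneg φ.nonneg]
        exact mul_le_of_le_one_left (norm_nonneg _) φ.le_one
      · rw [ContinuousLinearMap.norm_smulRight_apply, ContinuousLinearMap.comp_smul,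
          ContinuousLinearMap.comp_id, norm_smul, Real.norm_of_nonneg (hr n).le]
        have := hM (r n • x)
        have := (hr n).le
        gcongr
    refine (eLpNorm_mono hd).trans ((eLpNorm_add_le ?_ ?_ (by exact_mod_cast hp)).trans ?_)
    · exact (hu.continuous_fderiv one_ne_zero).norm.aestronglyMeasurable
    · exact (hu.continuous.norm.const_mul _).aestronglyMeasurable
    · have hM0 : 0 ≤ M := (norm_nonneg _).trans (hM 0)
      have := (hr n).le
      rw [eLpNorm_norm]
      gcongr
      change eLpNorm ((r n * M) • fun x ↦ ‖u x‖) p μ ≤ _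
      rw [eLpNorm_const_smul, eLpNorm_norm, Real.enorm_of_nonneg (by positivity)]
  have hconv : Tendsto (fun n ↦ (eLpNormLESNormFDerivOfEqInnerConst μ p : ℝ≥0∞) *
      (eLpNorm (fderiv ℝ u) p μ + ENNReal.ofReal (r n * M) * eLpNorm u p μ)) atTop
      (𝓝 (eLpNormLESNormFDerivOfEqInnerConst μ p * eLpNorm (fderiv ℝ u) p μ)) := by
    refine ENNReal.Tendsto.const_mul ?_ (.inr ENNReal.coe_ne_top)
    have h1 : Tendsto (fun n ↦ ENNReal.ofReal (r n * M)) atTop (𝓝 0) := by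
      simpa using ENNReal.tendsto_ofReal (hr0.mul_const M)
    have h2 := ENNReal.Tendsto.mul_const h1 (.inr hup.eLpNorm_ne_top)
    simpa using h2.const_add (eLpNorm (fderiv ℝ u) p μ)
  refine (Lp.eLpNorm_lim_le_liminf_eLpNorm
    (fun n ↦ (hw n).continuous.aestronglyMeasurable) u (.of_forall hlim)).trans ?_
  rw [← hconv.liminf_eq]
  refine liminf_le_liminf (.of_forall fun n ↦ ?_)
  exact (eLpNorm_le_eLpNorm_fderiv_of_eq_inner μ (hw n) (hwc n) hp hn hp').trans
    (by gcongr; exact hbound n)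

theorem ContinuousLinearMap.norm_sq_le_sum_basis {ι E F : Type*} [Fintype ι] [NormedAddCommGroup E]
    [InnerProductSpace ℝ E] [NormedAddCommGroup F] [NormedSpace ℝ F] (b : OrthonormalBasis ι ℝ E)
    (L : E →L[ℝ] F) : ‖L‖ ^ 2 ≤ ∑ i, ‖L (b i)‖ ^ 2 := by
  refine (Real.le_sqrt (norm_nonneg _) (by positivity)).1
    (L.opNorm_le_bound (Real.sqrt_nonneg _) fun x ↦ ?_)
  calc ‖L x‖ = ‖∑ i, b.repr x i • L (b i)‖ := by
        conv_lhs => rw [← b.sum_repr x]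
        simp
    _ ≤ ∑ i, ‖L (b i)‖ * ‖b.repr x i‖ :=
        norm_sum_le_of_le _ fun i _ ↦ by rw [norm_smul, mul_comm]
    _ ≤ √(∑ i, ‖L (b i)‖ ^ 2) * √(∑ i, ‖b.repr x i‖ ^ 2) :=
        Real.sum_mul_le_sqrt_mul_sqrt _ _ _
    _ = √(∑ i, ‖L (b i)‖ ^ 2) * ‖x‖ := by
        rw [← EuclideanSpace.norm_eq, b.repr.norm_map]

theorem eLpNorm_fderiv_two_sq_le {N : ℕ} (u : SchwartzMap (EuclideanSpace ℝ (Fin N)) ℝ) :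
    eLpNorm (fderiv ℝ u) 2 volume ^ 2 ≤
      ENNReal.ofReal (∑ i, ∫ x, (∂_{basisVec N i} u x) ^ 2) := by
  have hint : ∀ i ∈ Finset.univ, Integrable (fun x ↦ (∂_{basisVec N i} u x) ^ 2) :=
    fun i _ ↦ ((∂_{basisVec N i} u).memLp 2).integrable_sq
  have h := eLpNorm_nnreal_pow_eq_lintegral (f := fderiv ℝ u)
    (μ := (volume : Measure (EuclideanSpace ℝ (Fin N)))) (p := 2) two_ne_zero
  simp only [NNReal.coe_ofNat, ENNReal.coe_ofNat, ENNReal.rpow_ofNat] at h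
  rw [h, ← integral_finsetSum _ hint, ofReal_integral_eq_lintegral_ofReal
    (integrable_finsetSum _ hint) (.of_forall fun x ↦ by positivity)]
  refine lintegral_mono fun x ↦ ?_
  rw [← ofReal_norm, ← ENNReal.ofReal_pow (norm_nonneg _)]
  refine ENNReal.ofReal_le_ofReal ?_
  have h := (fderiv ℝ u x).norm_sq_le_sum_basis (EuclideanSpace.basisFun (Fin N) ℝ)
  simpa [basisVec, SchwartzMap.lineDerivOp_apply_eq_fderiv] using h

theorem integral_mul_sub_lap {N : ℕ} (u : SchwartzMap (EuclideanSpace ℝ (Fin N)) ℝ) (c : ℝ) :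
    ∫ x, u x * (u x - c * lap N (fun y ↦ u y) x) =
      (∫ x, u x ^ 2) + c * ∑ i, ∫ x, (∂_{basisVec N i} u x) ^ 2 := by
  have hint : ∀ i ∈ Finset.univ, Integrable
      (fun x ↦ u x * ∂_{basisVec N i} (∂_{basisVec N i} u) x) :=
    fun i _ ↦ (u.memLp 2).integrable_mul ((∂_{basisVec N i} (∂_{basisVec N i} u)).memLp 2)
  have hsq : Integrable (fun x ↦ u x ^ 2) := (u.memLp 2).integrable_sq
  have hsum : Integrable (fun x ↦ c * ∑ i, u x * ∂_{basisVec N i} (∂_{basisVec N i} u) x) :=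
    (integrable_finsetSum _ hint).const_mul c
  have hlap : ∀ x, u x * (u x - c * lap N (fun y ↦ u y) x) =
      u x ^ 2 - c * ∑ i, u x * ∂_{basisVec N i} (∂_{basisVec N i} u) x := fun x ↦ by
    have : lap N (fun y ↦ u y) x = ∑ i, ∂_{basisVec N i} (∂_{basisVec N i} u) x := rfl
    rw [this, ← Finset.mul_sum]
    ring
  simp_rw [hlap]
  rw [integral_sub hsq hsum, integral_const_mul, integral_finsetSum _ hint]
  have hparts : ∀ i, ∫ x, u x * ∂_{basisVec N i} (∂_{basisVec N i} u) x =
      -∫ x, (∂_{basisVec N i} u x) ^ 2 := fun i ↦ by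
    simp only [SchwartzMap.integral_mul_lineDerivOp_right_eq_neg_left u, pow_two]
  rw [Finset.sum_congr rfl fun i _ ↦ hparts i, Finset.sum_neg_distrib]
  ring

/-- for `N ≥ 3`, the estimate
`|∫ u |v|^{σ+1} dx| ≤ C_α ‖v‖_{L^{2N(σ+1)/(N+2)}}^{2(σ+1)}`
for the solution of the Helmholtz equation `u - α²Δu = |v|^{σ+1}`. -/
theorem stmt8 (N : ℕ) (hN : 3 ≤ N) (α : ℝ) (hα : 0 < α) (σ : ℝ) (hσ : 1 ≤ σ) :
    ∃ C : ℝ, 0 < C ∧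
      ∀ (v : SchwartzMap (EuclideanSpace ℝ (Fin N)) ℂ)
        (u : SchwartzMap (EuclideanSpace ℝ (Fin N)) ℝ),
        (∀ x, u x - α ^ 2 * lap N (fun y => u y) x = ‖v x‖ ^ (σ + 1)) →
        |∫ x, u x * ‖v x‖ ^ (σ + 1)|
          ≤ C * (LpN N (fun x => v x) (2 * N * (σ + 1) / ((N : ℝ) + 2))) ^ (2 * (σ + 1)) := by
  have hN' : (3 : ℝ) ≤ N := by exact_mod_cast hN
  obtain ⟨p', hp'⟩ : ∃ p' : ℝ≥0, (p' : ℝ) = 2 * N / (N - 2) :=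
    ⟨⟨2 * N / (N - 2), div_nonneg (by positivity) (by linarith)⟩, rfl⟩
  obtain ⟨q, hq⟩ : ∃ q : ℝ≥0, (q : ℝ) = 2 * N / (N + 2) :=
    ⟨⟨2 * N / (N + 2), by positivity⟩, rfl⟩
  have hp'0 : p' ≠ 0 := by
    rw [← NNReal.coe_ne_zero, hp']
    exact (div_pos (by linarith) (by linarith)).ne'
  have hq0 : q ≠ 0 := by
    rw [← NNReal.coe_ne_zero, hq]
    exact (div_pos (by linarith) (by linarith)).ne'
  have hfin : Module.finrank ℝ (EuclideanSpace ℝ (Fin N)) = N := by simp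
  have hsob : (p' : ℝ)⁻¹ = ((2 : ℝ≥0) : ℝ)⁻¹ -
      (Module.finrank ℝ (EuclideanSpace ℝ (Fin N)) : ℝ)⁻¹ := by
    have : (N : ℝ) - 2 ≠ 0 := by linarith
    rw [hfin, hp', NNReal.coe_ofNat]
    field_simp
  have : ENNReal.HolderTriple p' q 1 := ⟨by
    rw [← ENNReal.coe_inv hp'0, ← ENNReal.coe_inv hq0, ← ENNReal.coe_add, inv_one]
    norm_cast
    rw [← NNReal.coe_inj, NNReal.coe_add, NNReal.coe_inv, NNReal.coe_inv, NNReal.coe_one, hp', hq]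
    field_simp
    ring⟩
  set K : ℝ≥0 := eLpNormLESNormFDerivOfEqInnerConst
    (volume : Measure (EuclideanSpace ℝ (Fin N))) (2 : ℝ≥0)
  refine ⟨K ^ 2 / α ^ 2 + 1, by positivity, fun v u huv ↦ ?_⟩
  set f : EuclideanSpace ℝ (Fin N) → ℝ := fun x ↦ ‖v x‖ ^ (σ + 1) with hf
  have hfc : Continuous f := v.continuous.norm.rpow_const fun x ↦ .inr (by linarith)
  set L := LpN N (fun x ↦ v x) (2 * N * (σ + 1) / ((N : ℝ) + 2))
  have hL : 0 ≤ L := ENNReal.toReal_nonneg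
  have hLv : ENNReal.ofReal L =
      eLpNorm v (ENNReal.ofReal (2 * N * (σ + 1) / ((N : ℝ) + 2))) volume :=
    ENNReal.ofReal_toReal (v.eLpNorm_lt_top _ volume).ne
  set I : ℝ := ∫ x, u x * f x
  set G : ℝ := ∑ i, ∫ x, (∂_{basisVec N i} u x) ^ 2
  have hG0 : 0 ≤ G := Finset.sum_nonneg fun i _ ↦ integral_nonneg fun x ↦ sq_nonneg _
  have henergy : I = (∫ x, u x ^ 2) + α ^ 2 * G := by
    rw [← integral_mul_sub_lap]
    simp_rw [huv]
    rfl
  have hu2 : 0 ≤ ∫ x, u x ^ 2 := integral_nonneg fun x ↦ sq_nonneg _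
  have hfq : eLpNorm f q volume = ENNReal.ofReal (L ^ (σ + 1)) := by
    have hexp : (q : ℝ≥0∞) * ENNReal.ofReal (σ + 1) =
        ENNReal.ofReal (2 * N * (σ + 1) / ((N : ℝ) + 2)) := by
      rw [← ENNReal.ofReal_coe_nnreal, ← ENNReal.ofReal_mul q.coe_nonneg]
      congr 1
      rw [hq]
      ring
    rw [hf, eLpNorm_norm_rpow _ (by linarith), hexp,
      ← ENNReal.ofReal_rpow_of_nonneg hL (by linarith), hLv]
  have hgrad : eLpNorm (fderiv ℝ u) 2 volume ≤ ENNReal.ofReal √G := by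
    refine (ENNReal.pow_le_pow_left_iff two_ne_zero).1 ?_
    rw [← ENNReal.ofReal_pow (Real.sqrt_nonneg _), Real.sq_sqrt hG0]
    exact eLpNorm_fderiv_two_sq_le u
  have hholder : |I| ≤ K * √G * L ^ (σ + 1) := by
    rw [← ENNReal.ofReal_le_ofReal_iff (by positivity)]
    calc ENNReal.ofReal |I| = ‖I‖ₑ := by rw [← Real.norm_eq_abs, ofReal_norm]
      _ ≤ ∫⁻ x, ‖u x * f x‖ₑ := enorm_integral_le_lintegral_enorm _
      _ = eLpNorm ((u : EuclideanSpace ℝ (Fin N) → ℝ) • f) 1 volume := by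
        rw [eLpNorm_one_eq_lintegral_enorm]; rfl
      _ ≤ eLpNorm u p' volume * eLpNorm f q volume :=
        eLpNorm_smul_le_mul_eLpNorm hfc.aestronglyMeasurable u.continuous.aestronglyMeasurable
      _ ≤ (K * ENNReal.ofReal √G) * ENNReal.ofReal (L ^ (σ + 1)) := by
        rw [hfq]
        gcongr
        refine (eLpNorm_le_eLpNorm_fderiv_of_memLp volume (u.smooth 1) (p := 2) (p' := p')
          one_le_two (u.memLp _) (by rw [hfin]; omega) hsob).trans ?_
        gcongr
        exact hgrad
      _ = ENNReal.ofReal (K * √G * L ^ (σ + 1)) := by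
        rw [ENNReal.ofReal_mul (by positivity), ENNReal.ofReal_mul (by positivity),
          ENNReal.ofReal_coe_nnreal]
  have hI0 : 0 ≤ I := by rw [henergy]; positivity
  have hpow : L ^ (2 * (σ + 1)) = (L ^ (σ + 1)) ^ 2 := by
    rw [mul_comm, Real.rpow_mul hL, Real.rpow_two]
  rw [hpow]
  set F := L ^ (σ + 1)
  have hF : 0 ≤ F := by positivity
  have hGI : G ≤ I / α ^ 2 := by
    rw [le_div_iff₀ (by positivity)]
    linarith
  rw [abs_of_nonneg hI0] at hholder ⊢
  have hsq : I * I ≤ (K ^ 2 / α ^ 2 * F ^ 2) * I := by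
    calc I * I ≤ (K * √G * F) * (K * √G * F) := by gcongr
      _ = K ^ 2 * F ^ 2 * (√G) ^ 2 := by ring
      _ = K ^ 2 * F ^ 2 * G := by rw [Real.sq_sqrt hG0]
      _ ≤ K ^ 2 * F ^ 2 * (I / α ^ 2) := by gcongr
      _ = _ := by ring
  rcases hI0.eq_or_lt with h0 | hpos
  · rw [← h0]
    positivity
  · have := le_of_mul_le_mul_right hsq hpos
    nlinarith [sq_nonneg F]
end
end

section
/- Let N ≥ 1, let t ∈ ℝ with t ≠ 0, and let 2 ≤ r ≤ ∞ with conjugate exponent r' (1/r + 1/r' = 1). For a Schwartz function φ : ℝ^N → ℂ define the free Schrödinger evolution (U(t)φ)(x) = (4π i t)^{−N/2} ∫_{ℝ^N} e^{i|x−y|²/(4t)} φ(y) dy. Then ‖U(t)φ‖_{L^r} ≤ (4π|t|)^{N/r − N/2} ‖φ‖_{L^{r'}}. -/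
open MeasureTheory Real Set
open scoped ENNReal NNReal ComplexConjugate

noncomputable section

/-- The free Schrödinger propagator `U(t) = exp(itΔ)`, given for `t ≠ 0` by the
oscillatory integral kernel `(U(t)φ)(x) = (4πit)^{-N/2} ∫ e^{i|x-y|²/(4t)} φ(y) dy`
(principal branch), and by the identity for `t = 0`. -/
def schrodingerProp (N : ℕ) (t : ℝ) (φ : EuclideanSpace ℝ (Fin N) → ℂ)
    (x : EuclideanSpace ℝ (Fin N)) : ℂ :=
  if t = 0 then φ x else
    (4 * (Real.pi : ℂ) * Complex.I * (t : ℂ)) ^ (-(N : ℂ) / 2) *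
      ∫ y, Complex.exp (Complex.I * ((‖x - y‖ ^ 2 / (4 * t) : ℝ) : ℂ)) * φ y

open scoped FourierTransform SchwartzMap RealInnerProductSpace ContDiff

theorem hasTemperateGrowth_cexp_mul_I :
    (fun s : ℝ => Complex.exp (s * Complex.I)).HasTemperateGrowth := by
  have hderiv (n : ℕ) (x : ℝ) : iteratedDeriv n (fun s : ℝ => Complex.exp (s * Complex.I)) x =
      Complex.I ^ n * Complex.exp (x * Complex.I) := by
    induction n generalizing x with
    | zero => simp
    | succ n ih =>
      rw [iteratedDeriv_succ, funext ih]
      have h := ((((hasDerivAt_id (x : ℂ)).mul_const Complex.I).cexp).comp_ofReal).const_mul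
        (Complex.I ^ n)
      simp only [id] at h
      rw [h.deriv]
      ring
  refine ⟨(Complex.ofRealCLM.contDiff.mul contDiff_const).cexp, fun n => ⟨0, 1, fun x => ?_⟩⟩
  rw [norm_iteratedFDeriv_eq_norm_iteratedDeriv, hderiv]
  simp [Complex.norm_exp_ofReal_mul_I]

section Fourier

variable {V : Type*} [NormedAddCommGroup V] [InnerProductSpace ℝ V] [FiniteDimensional ℝ V]
  [MeasurableSpace V] [BorelSpace V]

theorem fourier_ae_eq_fourier_toLp {a : V → ℂ} (ha : Integrable a) (ha2 : MemLp a 2) :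
    𝓕 a =ᵐ[volume] (𝓕 (ha2.toLp a) : Lp ℂ 2 (volume : Measure V)) := by
  have hcont : Continuous (𝓕 a) :=
    VectorFourier.fourierIntegral_continuous Real.continuous_fourierChar continuous_inner ha
  refine ae_eq_of_integral_contDiff_smul_eq hcont.locallyIntegrable
    ((Lp.memLp _).locallyIntegrable (by norm_num)) fun g hg hgs => ?_
  have hg₁ : HasCompactSupport (Complex.ofRealCLM ∘ g) := hgs.comp_left rfl
  have hg₂ : ContDiff ℝ ∞ (Complex.ofRealCLM ∘ g) := by fun_prop
  set G : 𝓢(V, ℂ) := hg₁.toSchwartzMap hg₂ with hG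
  have hGg (x : V) : G x = (g x : ℂ) := by simp [hG]
  have key := congrArg (fun T : 𝓢'(V, ℂ) => T G)
    (Lp.fourier_toTemperedDistribution_eq (ha2.toLp a))
  simp only [TemperedDistribution.fourier_apply, Lp.toTemperedDistribution_apply] at key
  have hflip : ∫ ξ, 𝓕 (G : V → ℂ) ξ • a ξ = ∫ x, G x • 𝓕 a x := by
    simpa using! VectorFourier.integral_fourierIntegral_smul_eq_flip (L := innerₗ V)
      Real.continuous_fourierChar continuous_inner G.integrable ha
  calc ∫ x, g x • 𝓕 a x = ∫ x, G x • 𝓕 a x := by simp [hGg]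
    _ = ∫ ξ, (𝓕 G) ξ • (ha2.toLp a) ξ := by
      rw [← hflip]
      refine integral_congr_ae ?_
      filter_upwards [ha2.coeFn_toLp] with x hx
      rw [hx, SchwartzMap.fourier_coe]
    _ = _ := by rw [key]; simp [hGg]

theorem memLp_two_fourier {a : V → ℂ} (ha : Integrable a) (ha2 : MemLp a 2) :
    MemLp (𝓕 a) 2 :=
  (memLp_congr_ae (fourier_ae_eq_fourier_toLp ha ha2)).2 (Lp.memLp _)

theorem eLpNorm_two_fourier {a : V → ℂ} (ha : Integrable a) (ha2 : MemLp a 2) :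
    eLpNorm (𝓕 a) 2 = eLpNorm a 2 := by
  rw [eLpNorm_congr_ae (fourier_ae_eq_fourier_toLp ha ha2), ← Lp.enorm_def, ← ofReal_norm,
    Lp.norm_fourier_eq, ofReal_norm, Lp.enorm_def, eLpNorm_congr_ae ha2.coeFn_toLp]

theorem norm_integral_fourier_mul_le {a b : V → ℂ} (ha : Integrable a) (ha2 : MemLp a 2)
    (hb2 : MemLp b 2) :
    ‖∫ ξ, 𝓕 a ξ * b ξ‖ ≤
      (∫ x, ‖a x‖ ^ (2 : ℝ)) ^ (1 / 2 : ℝ) * (∫ x, ‖b x‖ ^ (2 : ℝ)) ^ (1 / 2 : ℝ) := by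
  have hF := memLp_two_fourier ha ha2
  have hnorm : (∫ x, ‖𝓕 a x‖ ^ (2 : ℝ)) ^ (1 / 2 : ℝ) = (∫ x, ‖a x‖ ^ (2 : ℝ)) ^ (1 / 2 : ℝ) := by
    have h := eLpNorm_two_fourier ha ha2
    rw [hF.eLpNorm_eq_integral_rpow_norm (by simp) (by simp),
      ha2.eLpNorm_eq_integral_rpow_norm (by simp) (by simp),
      ENNReal.ofReal_eq_ofReal_iff (by positivity) (by positivity)] at h
    simpa using h
  rw [← hnorm]
  refine (norm_integral_le_integral_norm _).trans ?_
  simp only [norm_mul]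
  exact integral_mul_norm_le_Lp_mul_Lq (by rw [Real.holderConjugate_iff]; norm_num)
    (by simpa using hF) (by simpa using hb2)

end Fourier

theorem rpow_mul_abs_log_le {G x₀ x : ℝ} (hG : 0 ≤ G) (hx₀ : 0 < x₀) (h1 : x₀ / 2 < x)
    (h2 : x < 3 * x₀ / 2) :
    G ^ x * |Real.log G| ≤ 4 / x₀ * (G ^ (x₀ / 4) + G ^ (2 * x₀)) := by
  rcases hG.eq_or_lt with rfl | hG
  · simp only [Real.log_zero, abs_zero, mul_zero]
    positivity
  rcases le_total G 1 with h | h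
  · have hl := (abs_log_mul_self_rpow_lt G (x₀ / 4) hG h (by positivity)).le
    rw [abs_mul, abs_of_nonneg (rpow_nonneg hG.le (x₀ / 4))] at hl
    calc G ^ x * |Real.log G| ≤ G ^ (x₀ / 4 + x₀ / 4) * |Real.log G| := by
          gcongr ?_ * _
          exact rpow_le_rpow_of_exponent_ge hG h (by linarith)
      _ = G ^ (x₀ / 4) * (|Real.log G| * G ^ (x₀ / 4)) := by rw [rpow_add hG]; ring
      _ ≤ G ^ (x₀ / 4) * (1 / (x₀ / 4)) := by gcongr
      _ = 4 / x₀ * G ^ (x₀ / 4) := by field_simp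
      _ ≤ _ := by gcongr; linarith [rpow_nonneg hG.le (2 * x₀)]
  · have hl := Real.log_le_rpow_div hG.le (show 0 < x₀ / 2 by positivity)
    rw [abs_of_nonneg (Real.log_nonneg h)]
    calc G ^ x * Real.log G ≤ G ^ (3 * x₀ / 2) * (G ^ (x₀ / 2) / (x₀ / 2)) := by
          gcongr
          exact Real.log_nonneg h
      _ = 2 / x₀ * G ^ (2 * x₀) := by
          rw [show 2 * x₀ = 3 * x₀ / 2 + x₀ / 2 by ring, rpow_add hG]; field_simp
      _ ≤ 4 / x₀ * (G ^ (x₀ / 4) + G ^ (2 * x₀)) := by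
          gcongr
          · norm_num
          · linarith [rpow_nonneg hG.le (x₀ / 4)]

theorem norm_mul_cpow_le {a : ℂ} {g : ℝ} (ha : ‖a‖ ≤ 1) (hg : 0 ≤ g) {z : ℂ} (hz : 0 < z.re) :
    ‖a * (g : ℂ) ^ z‖ ≤ g ^ z.re := by
  rw [norm_mul, Complex.norm_cpow_eq_rpow_re_of_nonneg hg hz.ne']
  exact mul_le_of_le_one_left (rpow_nonneg hg _) ha

theorem integrable_mul_cpow {Ω : Type*} [MeasurableSpace Ω] {μ : Measure Ω} {A : Ω → ℂ}
    {G : Ω → ℝ} (hA : AEStronglyMeasurable A μ) (hA1 : ∀ y, ‖A y‖ ≤ 1)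
    (hGm : AEMeasurable G μ) (hG : ∀ y, 0 ≤ G y) {z : ℂ} (hz : 0 < z.re)
    (hint : Integrable (fun y => G y ^ z.re) μ) :
    Integrable (fun y => A y * (G y : ℂ) ^ z) μ := by
  refine hint.mono (hA.mul
    ((Complex.measurable_ofReal.comp_aemeasurable hGm).pow_const z).aestronglyMeasurable)
    (ae_of_all _ fun y => ?_)
  rw [Real.norm_of_nonneg (rpow_nonneg (hG y) _)]
  exact norm_mul_cpow_le (hA1 y) (hG y) hz

theorem differentiableAt_integral_mul_cpow {Ω : Type*} [MeasurableSpace Ω] {μ : Measure Ω}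
    {A : Ω → ℂ} {G : Ω → ℝ} (hA : AEStronglyMeasurable A μ) (hA1 : ∀ y, ‖A y‖ ≤ 1)
    (hGm : AEMeasurable G μ) (hG : ∀ y, 0 ≤ G y)
    (hint : ∀ s : ℝ, 0 < s → Integrable (fun y => G y ^ s) μ) {z : ℂ} (hz : 0 < z.re) :
    DifferentiableAt ℂ (fun z : ℂ => ∫ y, A y * (G y : ℂ) ^ z ∂μ) z := by
  have hmeas (w : ℂ) : AEStronglyMeasurable (fun y => A y * (G y : ℂ) ^ w) μ :=
    hA.mul ((Complex.measurable_ofReal.comp_aemeasurable hGm).pow_const w).aestronglyMeasurable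
  have hnorm (w : ℂ) (hw : 0 < w.re) (y : Ω) : ‖(G y : ℂ) ^ w‖ = G y ^ w.re :=
    Complex.norm_cpow_eq_rpow_re_of_nonneg (hG y) hw.ne'
  have hre {w : ℂ} (hw : w ∈ Metric.ball z (z.re / 2)) : z.re / 2 < w.re ∧ w.re < 3 * z.re / 2 := by
    have h := (Complex.abs_re_le_norm (w - z)).trans_lt (mem_ball_iff_norm.1 hw)
    rw [Complex.sub_re, abs_lt] at h
    constructor <;> linarith
  refine (hasDerivAt_integral_of_dominated_loc_of_deriv_le
    (F' := fun w y => A y * ((G y : ℂ) ^ w * Complex.log (G y)))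
    (bound := fun y => 4 / z.re * (G y ^ (z.re / 4) + G y ^ (2 * z.re)))
    (Metric.ball_mem_nhds z (half_pos hz)) (.of_forall hmeas) ?_ ?_ ?_ ?_ ?_).2.differentiableAt
  · exact integrable_mul_cpow hA hA1 hGm hG hz (hint z.re hz)
  · have hGc := Complex.measurable_ofReal.comp_aemeasurable hGm
    exact hA.mul ((hGc.pow_const z).mul
      (Complex.measurable_log.comp_aemeasurable hGc)).aestronglyMeasurable
  · refine ae_of_all _ fun y w hw => ?_
    obtain ⟨h1, h2⟩ := hre hw
    rw [norm_mul, norm_mul, hnorm w (by linarith), ← Complex.ofReal_log (hG y),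
      Complex.norm_real, Real.norm_eq_abs]
    exact (mul_le_of_le_one_left (mul_nonneg (rpow_nonneg (hG y) _) (abs_nonneg _)) (hA1 y)).trans
      (rpow_mul_abs_log_le (hG y) hz h1 h2)
  · exact ((hint _ (by positivity)).add (hint _ (by positivity))).const_mul _
  · refine ae_of_all _ fun y w hw => ?_
    have hw0 : w ≠ 0 := fun h => by
      have := (hre hw).1
      simp only [h, Complex.zero_re] at this
      linarith
    simpa using ((hasDerivAt_id w).const_cpow (c := (G y : ℂ)) (Or.inr hw0)).const_mul (A y)

section HausdorffYoung

variable {V : Type*} [NormedAddCommGroup V] [InnerProductSpace ℝ V] [FiniteDimensional ℝ V]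
  [MeasurableSpace V] [BorelSpace V]

theorem norm_integral_fourier_mul_cpow_le_of_re_eq_half {α β : V → ℂ} {u v : V → ℝ}
    (hα : Measurable α) (hβ : Measurable β) (hα1 : ∀ x, ‖α x‖ ≤ 1) (hβ1 : ∀ x, ‖β x‖ ≤ 1)
    (hu : Measurable u) (hv : Measurable v) (hu0 : ∀ x, 0 ≤ u x) (hv0 : ∀ x, 0 ≤ v x)
    (hui : ∀ s : ℝ, 0 < s → Integrable (fun x => u x ^ s))
    (hvi : ∀ s : ℝ, 0 < s → Integrable (fun x => v x ^ s)) {w : ℂ} (hw : w.re = 1 / 2) :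
    ‖∫ ξ, 𝓕 (fun x => α x * (u x : ℂ) ^ w) ξ * (β ξ * (v ξ : ℂ) ^ w)‖ ≤
      ((∫ x, u x) * ∫ x, v x) ^ (1 / 2 : ℝ) := by
  have hw0 : 0 < w.re := by rw [hw]; norm_num
  have hsq {a : ℂ} {g : ℝ} (ha : ‖a‖ ≤ 1) (hg : 0 ≤ g) : ‖a * (g : ℂ) ^ w‖ ^ 2 ≤ g := by
    calc ‖a * (g : ℂ) ^ w‖ ^ 2 ≤ (g ^ w.re) ^ 2 := by
          gcongr
          exact norm_mul_cpow_le ha hg hw0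
      _ = g := by rw [hw, ← Real.sqrt_eq_rpow, Real.sq_sqrt hg]
  have hL2 {a : V → ℂ} {g : V → ℝ} (ha : Measurable a) (ha1 : ∀ x, ‖a x‖ ≤ 1) (hg : Measurable g)
      (hg0 : ∀ x, 0 ≤ g x) (hgi : ∀ s : ℝ, 0 < s → Integrable (fun x => g x ^ s)) :
      MemLp (fun x => a x * (g x : ℂ) ^ w) 2 ∧
      ∫ x, ‖a x * (g x : ℂ) ^ w‖ ^ (2 : ℝ) ≤ ∫ x, g x := by
    have hm : Measurable (fun x => a x * (g x : ℂ) ^ w) :=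
      ha.mul ((Complex.measurable_ofReal.comp hg).pow_const w)
    have hg1 : Integrable g := by simpa using hgi 1 one_pos
    have hi : Integrable (fun x => ‖a x * (g x : ℂ) ^ w‖ ^ 2) :=
      hg1.mono' (hm.norm.pow_const 2).aestronglyMeasurable
        (ae_of_all _ fun x => by simpa using hsq (ha1 x) (hg0 x))
    refine ⟨(memLp_two_iff_integrable_sq_norm hm.aestronglyMeasurable).2 hi, ?_⟩
    simp only [Real.rpow_two]
    exact integral_mono hi hg1 fun x => hsq (ha1 x) (hg0 x)
  obtain ⟨ha2, hale⟩ := hL2 hα hα1 hu hu0 hui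
  obtain ⟨hb2, hble⟩ := hL2 hβ hβ1 hv hv0 hvi
  have ha := integrable_mul_cpow (μ := (volume : Measure V)) hα.aestronglyMeasurable hα1
    hu.aemeasurable hu0 hw0 (hui _ hw0)
  refine (norm_integral_fourier_mul_le ha ha2 hb2).trans ?_
  rw [Real.mul_rpow (integral_nonneg hu0) (integral_nonneg hv0)]
  have := integral_nonneg (μ := (volume : Measure V)) (f := u) hu0
  gcongr

theorem norm_integral_fourier_mul_rpow_le {α β : V → ℂ} {u v : V → ℝ}
    (hα : Measurable α) (hβ : Measurable β) (hα1 : ∀ x, ‖α x‖ ≤ 1) (hβ1 : ∀ x, ‖β x‖ ≤ 1)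
    (hu : Measurable u) (hv : Measurable v) (hu0 : ∀ x, 0 ≤ u x) (hv0 : ∀ x, 0 ≤ v x)
    (hui : ∀ s : ℝ, 0 < s → Integrable (fun x => u x ^ s))
    (hvi : ∀ s : ℝ, 0 < s → Integrable (fun x => v x ^ s)) {s : ℝ} (hs : s ∈ Icc (1 / 2 : ℝ) 1) :
    ‖∫ ξ, 𝓕 (fun x => α x * (u x : ℂ) ^ (s : ℂ)) ξ * (β ξ * (v ξ : ℂ) ^ (s : ℂ))‖ ≤
      ((∫ x, u x) * ∫ x, v x) ^ s := by
  set μ : Measure (V × V) := (volume : Measure V).prod volume with hμ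
  set A : V × V → ℂ := fun y => (Real.fourierChar (-inner ℝ y.1 y.2) : ℂ) * (α y.1 * β y.2) with hA
  set G : V × V → ℝ := fun y => u y.1 * v y.2 with hG
  have hG0 (y) : 0 ≤ G y := mul_nonneg (hu0 _) (hv0 _)
  have hGm : Measurable G := (hu.comp measurable_fst).mul (hv.comp measurable_snd)
  have hAm : Measurable A := by
    refine Measurable.mul ?_ ((hα.comp measurable_fst).mul (hβ.comp measurable_snd))
    have : Continuous fun y : V × V => (Real.fourierChar (-inner ℝ y.1 y.2) : ℂ) :=
      continuous_subtype_val.comp (Real.continuous_fourierChar.comp (by fun_prop))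
    exact this.measurable
  have hA1 (y) : ‖A y‖ ≤ 1 := by
    simp only [hA, norm_mul, Circle.norm_coe, one_mul]
    exact mul_le_one₀ (hα1 _) (norm_nonneg _) (hβ1 _)
  have hGi (s : ℝ) (hs : 0 < s) : Integrable (fun y => G y ^ s) μ := by
    refine ((hui s hs).mul_prod (hvi s hs)).congr (ae_of_all _ fun y => ?_)
    simp only [hG, Real.mul_rpow (hu0 y.1) (hv0 y.2)]
  set Φ : ℂ → ℂ := fun w => ∫ y, A y * (G y : ℂ) ^ w ∂μ with hΦ
  have hΦeq {w : ℂ} (hw : 0 < w.re) :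
      Φ w = ∫ ξ, 𝓕 (fun x => α x * (u x : ℂ) ^ w) ξ * (β ξ * (v ξ : ℂ) ^ w) := by
    have hi := integrable_mul_cpow (μ := μ) hAm.aestronglyMeasurable hA1 hGm.aemeasurable hG0 hw
      (hGi _ hw)
    simp only [hΦ, hμ]
    rw [integral_prod_symm _ hi]
    refine integral_congr_ae (ae_of_all _ fun ξ => ?_)
    simp only [Real.fourier_eq]
    rw [← integral_mul_const]
    refine integral_congr_ae (ae_of_all _ fun x => ?_)
    simp only [hA, hG, Circle.smul_def, smul_eq_mul]
    rw [Complex.ofReal_mul, Complex.mul_cpow_ofReal_nonneg (hu0 x) (hv0 ξ)]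
    ring
  have hΦle {w : ℂ} (hw : 0 < w.re) : ‖Φ w‖ ≤ ∫ y, G y ^ w.re ∂μ :=
    norm_integral_le_of_norm_le (hGi _ hw)
      (ae_of_all _ fun y => norm_mul_cpow_le (hA1 y) (hG0 y) hw)
  have hP : 0 ≤ (∫ x, u x) * ∫ x, v x := mul_nonneg (integral_nonneg hu0) (integral_nonneg hv0)
  have hd (w : ℂ) (hw : 0 < w.re) : DifferentiableAt ℂ Φ w :=
    differentiableAt_integral_mul_cpow hAm.aestronglyMeasurable hA1 hGm.aemeasurable hG0 hGi hw
  have hdiff : DiffContOnCl ℂ Φ (Complex.HadamardThreeLines.verticalStrip (1 / 2) 1) := by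
    refine DifferentiableOn.diffContOnCl fun w hw => (hd w ?_).differentiableWithinAt
    have hcl : closure (Complex.HadamardThreeLines.verticalStrip (1 / 2) 1) ⊆
        Complex.re ⁻¹' Icc (1 / 2) 1 :=
      closure_minimal (preimage_mono Ioo_subset_Icc_self)
        (isClosed_Icc.preimage Complex.continuous_re)
    linarith [(hcl hw).1]
  have hbdd : BddAbove ((norm ∘ Φ) ''
      Complex.HadamardThreeLines.verticalClosedStrip (1 / 2) 1) := by
    refine ⟨∫ y, (G y ^ (1 / 2 : ℝ) + G y ^ (1 : ℝ)) ∂μ, ?_⟩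
    rintro _ ⟨w, hw, rfl⟩
    have hw' : w.re ∈ Icc (1 / 2 : ℝ) 1 := hw
    have hw0 : 0 < w.re := by linarith [hw'.1]
    refine (hΦle hw0).trans (integral_mono (hGi _ hw0)
      ((hGi _ (by norm_num)).add (hGi _ one_pos)) fun y => ?_)
    rcases (hG0 y).eq_or_lt with h | h
    · simp [← h, hw0.ne']
    rcases le_total (G y) 1 with h1 | h1
    · exact (rpow_le_rpow_of_exponent_ge h h1 hw'.1).trans
        (le_add_of_nonneg_right (rpow_nonneg h.le _))
    · exact (rpow_le_rpow_of_exponent_le h1 hw'.2).trans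
        (le_add_of_nonneg_left (rpow_nonneg h.le _))
  have key := Complex.HadamardThreeLines.norm_le_interp_of_mem_verticalClosedStrip'
    (f := Φ) (z := (s : ℂ)) (a := ((∫ x, u x) * ∫ x, v x) ^ (1 / 2 : ℝ))
    (b := (∫ x, u x) * ∫ x, v x) (by norm_num) (show (s : ℂ).re ∈ Icc (1 / 2 : ℝ) 1 from hs) hdiff hbdd
    (fun w hw => by
      have hw' : w.re = 1 / 2 := hw
      rw [hΦeq (by rw [hw']; norm_num)]
      exact norm_integral_fourier_mul_cpow_le_of_re_eq_half hα hβ hα1 hβ1 hu hv hu0 hv0 hui hvi hw')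
    (fun w hw => by
      have hw' : w.re = 1 := hw
      refine (hΦle (by rw [hw']; norm_num)).trans_eq ?_
      simp only [hw', Real.rpow_one, hG, hμ]
      exact integral_prod_mul u v)
  have hs0 : 0 < s := by linarith [hs.1]
  rw [hΦeq (by simpa using hs0)] at key
  refine key.trans_eq ?_
  rw [Complex.ofReal_re, ← Real.rpow_mul hP]
  rw [show 1 / 2 * (1 - (s - 1 / 2) / (1 - 1 / 2)) = 1 - s by ring,
    show (s - 1 / 2) / (1 - 1 / 2) = 2 * s - 1 by ring,
    ← Real.rpow_add_of_nonneg hP (by linarith [hs.2]) (by linarith [hs.1])]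
  congr 1
  ring

theorem SchwartzMap.integrable_norm_rpow (f : 𝓢(V, ℂ)) {s : ℝ} (hs : 0 < s) :
    Integrable (fun x => ‖f x‖ ^ s) := by
  have h := (f.memLp (ENNReal.ofReal s)).integrable_norm_rpow
    (by simpa using hs) ENNReal.ofReal_ne_top
  rwa [ENNReal.toReal_ofReal hs.le] at h

/-- The Hausdorff–Young inequality for Schwartz functions. -/
theorem SchwartzMap.integral_norm_fourier_rpow_le (f : 𝓢(V, ℂ)) {p q : ℝ}
    (hpq : p.HolderConjugate q) (hq : 2 ≤ q) :
    (∫ ξ, ‖(𝓕 f : 𝓢(V, ℂ)) ξ‖ ^ q) ^ (1 / q) ≤ (∫ x, ‖f x‖ ^ p) ^ (1 / p) := by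
  have hp0 : 0 < p := hpq.pos
  have hq0 : 0 < q := hpq.symm.pos
  have hsum : 1 / p + 1 / q = 1 := by simpa using hpq.inv_add_inv_eq_one
  have hqinv : 1 / q ≤ 1 / 2 := one_div_le_one_div_of_le two_pos hq
  have hs : 1 / p ∈ Icc (1 / 2 : ℝ) 1 :=
    ⟨by linarith, by linarith [show (0 : ℝ) < 1 / q by positivity]⟩
  have hsign (z : ℂ) : ‖z / ‖z‖‖ ≤ 1 := by
    simpa using div_self_le_one ‖z‖
  have hint (g : 𝓢(V, ℂ)) {r : ℝ} (hr : 0 < r) (s : ℝ) (hs : 0 < s) :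
      Integrable (fun x => (‖g x‖ ^ r) ^ s) := by
    simpa only [← Real.rpow_mul (norm_nonneg _)] using g.integrable_norm_rpow (mul_pos hr hs)
  set F : 𝓢(V, ℂ) := 𝓕 f with hF
  have hfm : Measurable f := f.continuous.measurable
  have hFm : Measurable F := F.continuous.measurable
  have key := norm_integral_fourier_mul_rpow_le (α := fun x => f x / ‖f x‖)
    (β := fun ξ => conj (F ξ) / ‖conj (F ξ)‖) (u := fun x => ‖f x‖ ^ p)
    (v := fun ξ => ‖F ξ‖ ^ q)
    (hfm.div (Complex.measurable_ofReal.comp hfm.norm))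
    (((Complex.continuous_conj.measurable.comp hFm)).div
      (Complex.measurable_ofReal.comp (Complex.continuous_conj.measurable.comp hFm).norm))
    (fun x => hsign _) (fun x => hsign _) (hfm.norm.pow_const p) (hFm.norm.pow_const q)
    (fun x => by positivity) (fun x => by positivity) (hint f hp0) (hint F hq0) hs
  have ha : (fun x => f x / ‖f x‖ * ((‖f x‖ ^ p : ℝ) : ℂ) ^ ((1 / p : ℝ) : ℂ)) = f := by
    funext x
    rw [← Complex.ofReal_cpow (by positivity), ← Real.rpow_mul (norm_nonneg _),
      mul_one_div_cancel hp0.ne', Real.rpow_one]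
    by_cases h : f x = 0
    · simp [h]
    · field_simp [show (‖f x‖ : ℂ) ≠ 0 by simpa using h]
  have hb (ξ : V) : F ξ * (conj (F ξ) / ‖conj (F ξ)‖ *
      ((‖F ξ‖ ^ q : ℝ) : ℂ) ^ ((1 / p : ℝ) : ℂ)) = ((‖F ξ‖ ^ q : ℝ) : ℂ) := by
    rw [← Complex.ofReal_cpow (by positivity), RCLike.norm_conj]
    by_cases h : F ξ = 0
    · simp [h, hq0.ne']
    · have hn : 0 < ‖F ξ‖ := norm_pos_iff.2 h
      have hqp : q * (1 / p) = q - 1 := by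
        rw [show 1 / p = 1 - 1 / q by linarith]
        field_simp
      have hn' : (‖F ξ‖ : ℂ) ≠ 0 := Complex.ofReal_ne_zero.2 hn.ne'
      rw [← Real.rpow_mul hn.le, hqp, Real.rpow_sub_one hn.ne', Complex.ofReal_div, ← mul_assoc,
        mul_div_assoc' (F ξ), Complex.mul_conj']
      field_simp
  rw [ha, ← SchwartzMap.fourier_coe, ← hF] at key
  simp only [hb] at key
  rw [integral_complex_ofReal, Complex.norm_real, Real.norm_of_nonneg (by positivity)] at key
  have hP : 0 ≤ ∫ x, ‖f x‖ ^ p := by positivity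
  have hQ : 0 ≤ ∫ ξ, ‖F ξ‖ ^ q := by positivity
  rcases hQ.eq_or_lt with h | h
  · rw [← h, Real.zero_rpow (by positivity)]
    positivity
  · rw [Real.mul_rpow hP hQ] at key
    rw [show 1 / q = 1 - 1 / p by linarith, Real.rpow_sub h, Real.rpow_one]
    exact (div_le_iff₀ (by positivity)).2 key

theorem SchwartzMap.eLpNorm_fourier_le (f : 𝓢(V, ℂ)) {r r' : ℝ≥0∞} (hr : 2 ≤ r)
    (hconj : 1 / r + 1 / r' = 1) :
    eLpNorm (𝓕 f : 𝓢(V, ℂ)) r ≤ eLpNorm f r' := by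
  rcases eq_or_ne r ⊤ with rfl | hr_top
  · obtain rfl : r' = 1 := by simpa using hconj
    refine (eLpNormEssSup_le_of_ae_bound
      (ae_of_all _ fun x => f.norm_fourier_apply_le_toLp_one x)).trans_eq ?_
    rw [SchwartzMap.norm_toLp, ENNReal.ofReal_toReal (f.memLp 1 volume).eLpNorm_ne_top]
  have hr0 : r ≠ 0 := (two_pos.trans_le hr).ne'
  have hr'0 : r' ≠ 0 := by
    rintro rfl
    simp at hconj
  have hr'_top : r' ≠ ⊤ := by
    rintro rfl
    have : r = 1 := by simpa using hconj
    rw [this] at hr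
    norm_num at hr
  have hq : 2 ≤ r.toReal := by simpa using ENNReal.toReal_mono hr_top hr
  have hpq : r'.toReal.HolderConjugate r.toReal := by
    have h := congrArg ENNReal.toReal hconj
    rw [ENNReal.toReal_add (by simpa) (by simpa)] at h
    refine (Real.holderConjugate_iff.2 ⟨?_, by simpa using h⟩).symm
    linarith
  rw [((𝓕 f : 𝓢(V, ℂ)).memLp r volume).eLpNorm_eq_integral_rpow_norm hr0 hr_top,
    (f.memLp r' volume).eLpNorm_eq_integral_rpow_norm hr'0 hr'_top]
  simpa using ENNReal.ofReal_le_ofReal (f.integral_norm_fourier_rpow_le hpq hq)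

theorem eLpNorm_comp_smul (g : V → ℂ) (r : ℝ≥0∞) {c : ℝ} (hc : c ≠ 0) :
    eLpNorm (fun x => g (c • x)) r =
      ENNReal.ofReal |(c ^ Module.finrank ℝ V)⁻¹| ^ (1 / r).toReal * eLpNorm g r := by
  have hemb : MeasurableEmbedding (fun x : V => c • x) :=
    (Homeomorph.smulOfNeZero c hc).measurableEmbedding
  have hne : ENNReal.ofReal |(c ^ Module.finrank ℝ V)⁻¹| ≠ 0 := by
    simp [abs_pos, hc]
  have h := hemb.eLpNorm_map_measure (μ := volume) (p := r) (g := g)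
  rw [Measure.map_addHaar_smul volume hc, eLpNorm_smul_measure_of_ne_zero hne, smul_eq_mul] at h
  exact h.symm

end HausdorffYoung

section QuadraticPhase

variable {V : Type*} [NormedAddCommGroup V] [InnerProductSpace ℝ V]

/-- Multiplication of a Schwartz function by the quadratic phase `exp (i s ‖y‖ ^ 2)`. -/
def quadraticPhaseMul (s : ℝ) (φ : 𝓢(V, ℂ)) : 𝓢(V, ℂ) :=
  SchwartzMap.smulLeftCLM ℂ (fun y : V => Complex.exp ((s * ‖y‖ ^ 2 : ℝ) * Complex.I)) φ

theorem quadraticPhaseMul_apply (s : ℝ) (φ : 𝓢(V, ℂ)) (y : V) :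
    quadraticPhaseMul s φ y = Complex.exp ((s * ‖y‖ ^ 2 : ℝ) * Complex.I) * φ y := by
  have h : (fun y : V => s * ‖y‖ ^ 2).HasTemperateGrowth :=
    (Function.HasTemperateGrowth.const s).mul (Function.hasTemperateGrowth_norm_sq V)
  exact SchwartzMap.smulLeftCLM_apply_apply (hasTemperateGrowth_cexp_mul_I.comp h) φ y

theorem eLpNorm_quadraticPhaseMul [MeasurableSpace V] (μ : Measure V) (s : ℝ) (φ : 𝓢(V, ℂ)) (p : ℝ≥0∞) :
    eLpNorm (quadraticPhaseMul s φ) p μ = eLpNorm φ p μ :=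
  eLpNorm_congr_norm_ae (ae_of_all _ fun y => by
    rw [quadraticPhaseMul_apply, norm_mul, Complex.norm_exp_ofReal_mul_I, one_mul])

end QuadraticPhase

theorem norm_schrodingerProp {N : ℕ} {t : ℝ} (ht : t ≠ 0)
    (φ : 𝓢(EuclideanSpace ℝ (Fin N), ℂ)) (x : EuclideanSpace ℝ (Fin N)) :
    ‖schrodingerProp N t φ x‖ = (4 * π * |t|) ^ (-(N : ℝ) / 2) *
      ‖(𝓕 (quadraticPhaseMul (4 * t)⁻¹ φ) : 𝓢(EuclideanSpace ℝ (Fin N), ℂ))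
        ((4 * π * t)⁻¹ • x)‖ := by
  have hbase : 4 * (π : ℂ) * Complex.I * (t : ℂ) ≠ 0 := by
    simp [Real.pi_ne_zero, ht]
  have hconst : ‖(4 * (π : ℂ) * Complex.I * (t : ℂ)) ^ (-(N : ℂ) / 2)‖ =
      (4 * π * |t|) ^ (-(N : ℝ) / 2) := by
    rw [show (-(N : ℂ) / 2) = ((-(N : ℝ) / 2 : ℝ) : ℂ) by push_cast; rfl,
      Complex.norm_cpow_real]
    simp [abs_of_pos Real.pi_pos]
  have hphase (y : EuclideanSpace ℝ (Fin N)) :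
      Complex.exp (Complex.I * ((‖x - y‖ ^ 2 / (4 * t) : ℝ) : ℂ)) * φ y =
      Complex.exp (((4 * t)⁻¹ * ‖x‖ ^ 2 : ℝ) * Complex.I) *
        (Complex.exp (↑(-2 * π * inner ℝ y ((4 * π * t)⁻¹ • x)) * Complex.I) •
          quadraticPhaseMul (4 * t)⁻¹ φ y) := by
    rw [quadraticPhaseMul_apply, smul_eq_mul, ← mul_assoc, ← mul_assoc, ← Complex.exp_add,
      ← Complex.exp_add, ← add_mul, ← add_mul, ← Complex.ofReal_add, ← Complex.ofReal_add,
      mul_comm Complex.I, norm_sub_sq_real, real_inner_smul_right, real_inner_comm]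
    congr 5
    field_simp
    ring
  rw [schrodingerProp, if_neg ht, norm_mul, hconst, SchwartzMap.fourier_coe, Real.fourier_eq']
  simp only [hphase]
  rw [integral_const_mul, norm_mul, Complex.norm_exp_ofReal_mul_I, one_mul]

/-- the dispersive estimate
`‖U(t)φ‖_{L^r} ≤ (4π|t|)^{N/r - N/2} ‖φ‖_{L^{r'}}` for `2 ≤ r ≤ ∞`, `1/r + 1/r' = 1`. -/
theorem stmt13 (N : ℕ) (hN : 1 ≤ N) (t : ℝ) (ht : t ≠ 0)
    (r r' : ℝ≥0∞) (hr : 2 ≤ r) (hconj : 1 / r + 1 / r' = 1)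
    (φ : SchwartzMap (EuclideanSpace ℝ (Fin N)) ℂ) :
    eLpNorm (fun x => schrodingerProp N t (fun y => φ y) x) r volume
      ≤ ENNReal.ofReal
          ((4 * Real.pi * |t|) ^ ((N : ℝ) * (1 / r).toReal - (N : ℝ) / 2)) *
        eLpNorm (fun y => φ y) r' volume := by
  set F : 𝓢(EuclideanSpace ℝ (Fin N), ℂ) := 𝓕 (quadraticPhaseMul (4 * t)⁻¹ φ) with hF
  have hb : 0 < 4 * π * |t| := by positivity
  have hc : (4 * π * t)⁻¹ ≠ 0 := by positivity
  have habs : |((4 * π * t)⁻¹ ^ N)⁻¹| = (4 * π * |t|) ^ (N : ℝ) := by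
    rw [Real.rpow_natCast, inv_pow, inv_inv, abs_pow, abs_mul, abs_of_pos (by positivity)]
  calc eLpNorm (fun x => schrodingerProp N t (fun y => φ y) x) r volume
      = eLpNorm (((4 * π * |t|) ^ (-(N : ℝ) / 2)) • fun x => F ((4 * π * t)⁻¹ • x)) r volume := by
        refine eLpNorm_congr_norm_ae (ae_of_all _ fun x => ?_)
        rw [norm_schrodingerProp ht φ x, Pi.smul_apply, norm_smul,
          Real.norm_of_nonneg (rpow_nonneg hb.le _)]
    _ = ENNReal.ofReal ((4 * π * |t|) ^ ((N : ℝ) * (1 / r).toReal - (N : ℝ) / 2)) *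
        eLpNorm F r volume := by
        rw [eLpNorm_const_smul, eLpNorm_comp_smul F r hc, finrank_euclideanSpace_fin, habs,
          ENNReal.ofReal_rpow_of_nonneg (rpow_nonneg hb.le _) ENNReal.toReal_nonneg,
          ← Real.rpow_mul hb.le, Real.enorm_of_nonneg (rpow_nonneg hb.le _), ← mul_assoc,
          ← ENNReal.ofReal_mul (rpow_nonneg hb.le _), ← Real.rpow_add hb]
        congr 3
        ring
    _ ≤ _ := by
        gcongr
        exact (SchwartzMap.eLpNorm_fourier_le _ hr hconj).trans_eq
          (eLpNorm_quadraticPhaseMul volume _ φ r')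
end
end
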